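/- arXiv:1606.02521 — 2 statements merged into one kernel-verified Lean document; each statement's English description precedes it below -/
import Mathlib

section
/- Let k be an algebraically closed field of characteristic 0, let ε ∈ k^× and let ℓ ≥ 2 be an integer. Then the Nichols algebra B(V(ε,ℓ)) of the block V(ε,ℓ) has finite Gelfand–Kirillov dimension if and only if ℓ = 2 and ε ∈ {1, −1}; moreover, when ℓ = 2 and ε ∈ {1, −1}, GKdim B(V(ε,ℓ)) = 2. -/
open scoped ENNReal

/-- The Gelfand–Kirillov dimension of a `k`-algebra `A`:
the supremum, over all finite-dimensional subspaces `V ⊆ A`, of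
`limsup_{n→∞} log(dim ∑_{j=0}^n V^j) / log n`. -/
noncomputable def GKdim (k A : Type*) [Field k] [Ring A] [Algebra k A] : ℝ≥0∞ :=
  ⨆ (V : Submodule k A) (_ : FiniteDimensional k V),
    Filter.limsup
      (fun n : ℕ =>
        ENNReal.ofReal
          (Real.log ((Module.finrank k (↥(∑ j ∈ Finset.range (n + 1), V ^ j)) : ℕ) : ℝ) /
            Real.log (n : ℝ)))
      Filter.atTop

/-- The degree-`n` homogeneous component of the free algebra on `ℓ` generators. -/
noncomputable def degComp (k : Type*) [Field k] (ℓ n : ℕ) :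
    Submodule k (FreeAlgebra k (Fin ℓ)) :=
  (Submodule.span k (Set.range (FreeAlgebra.ι k : Fin ℓ → FreeAlgebra k (Fin ℓ)))) ^ n

/-- The generating set of the defining ideal of the Nichols algebra: all elements homogeneous
of tensor degree `n ≥ 2` annihilated by every `n`-fold composition of the skew derivations. -/
def nicholsSet {k : Type*} [Field k] {ℓ : ℕ}
    (D : Fin ℓ → (FreeAlgebra k (Fin ℓ) →ₗ[k] FreeAlgebra k (Fin ℓ))) :
    Set (FreeAlgebra k (Fin ℓ)) :=
  {x | ∃ n : ℕ, 2 ≤ n ∧ x ∈ degComp k ℓ n ∧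
    ∀ l : List (Fin ℓ), l.length = n → l.foldr (fun i y => D i y) x = 0}

/-- The relation whose `RingQuot` is the quotient by the two-sided ideal generated
by `nicholsSet D`, i.e. the Nichols algebra. -/
def nicholsRel {k : Type*} [Field k] {ℓ : ℕ}
    (D : Fin ℓ → (FreeAlgebra k (Fin ℓ) →ₗ[k] FreeAlgebra k (Fin ℓ)))
    (a b : FreeAlgebra k (Fin ℓ)) : Prop :=
  a ∈ nicholsSet D ∧ b = 0

/-- The algebra automorphism of the free algebra extending the action of the generator `g` of `ℤ`
on the block `V(ε,ℓ)`: `g·x_1 = ε x_1`, `g·x_j = ε x_j + x_{j-1}` (indices shifted by one). -/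
noncomputable def blockAut (k : Type*) [Field k] (ℓ : ℕ) (ε : k) :
    FreeAlgebra k (Fin ℓ) →ₐ[k] FreeAlgebra k (Fin ℓ) :=
  FreeAlgebra.lift k fun j : Fin ℓ =>
    ε • FreeAlgebra.ι k j +
      if (j : ℕ) = 0 then 0
      else FreeAlgebra.ι k
        (⟨(j : ℕ) - 1, Nat.lt_of_le_of_lt (Nat.sub_le _ _) j.isLt⟩ : Fin ℓ)


universe u

section GelfandKirillov

open Filter Topology

variable {k A B : Type*} [Field k] [Ring A] [Algebra k A] [Ring B] [Algebra k B]

lemma finiteDimensional_sum_pow (V : Submodule k A) [FiniteDimensional k V] (n : ℕ) :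
    FiniteDimensional k ↥(∑ j ∈ Finset.range (n + 1), V ^ j) := by
  have hV : V.FG := (Submodule.fg_iff_finiteDimensional V).2 inferInstance
  rw [← Submodule.fg_iff_finiteDimensional]
  exact Finset.sum_induction _ Submodule.FG (fun _ _ h h' => h.sup h') Submodule.fg_bot
    fun j _ => hV.pow j

lemma le_GKdim_of_tendsto {V : Submodule k A} [hV : FiniteDimensional k V] {φ : ℕ → ℕ}
    (hφ : Tendsto φ atTop atTop) {f : ℕ → ℝ} {L : ℝ≥0∞}
    (hf : ∀ᶠ r in atTop, f r ≤
      Real.log (Module.finrank k ↥(∑ j ∈ Finset.range (φ r + 1), V ^ j) : ℝ) / Real.log (φ r : ℝ))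
    (hL : Tendsto (fun r => ENNReal.ofReal (f r)) atTop (𝓝 L)) : L ≤ GKdim k A := by
  refine le_trans ?_ (le_iSup₂_of_le V hV le_rfl)
  rw [← hL.limsup_eq]
  refine le_trans (limsup_le_limsup (hf.mono fun r hr => ENNReal.ofReal_le_ofReal hr)) ?_
  exact limsup_le_limsup_of_le (f := map φ atTop) (u := fun n : ℕ => ENNReal.ofReal
    (Real.log (Module.finrank k ↥(∑ j ∈ Finset.range (n + 1), V ^ j) : ℝ) / Real.log (n : ℝ))) hφ

lemma tendsto_log_const_mul_sq_div_log {C : ℝ} (hC : 0 < C) :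
    Tendsto (fun n : ℕ => Real.log (C * (n + 1 : ℝ) ^ 2) / Real.log n) atTop (𝓝 2) := by
  have hlog : Tendsto (fun n : ℕ => Real.log n) atTop atTop :=
    Real.tendsto_log_atTop.comp tendsto_natCast_atTop_atTop
  have h1 : Tendsto (fun n : ℕ => Real.log (n + 1 : ℝ) - Real.log n) atTop (𝓝 0) :=
    Real.tendsto_log_nat_add_one_sub_log
  have h2 : Tendsto (fun n : ℕ => (Real.log C + 2 * (Real.log (n + 1 : ℝ) - Real.log n)) /
      Real.log n + 2) atTop (𝓝 (0 + 2)) :=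
    ((h1.const_mul 2).const_add (Real.log C)).div_atTop hlog |>.add_const 2
  rw [zero_add] at h2
  refine h2.congr' ?_
  filter_upwards [eventually_ge_atTop 2] with n hn
  have hn0 : Real.log n ≠ 0 := (Real.log_pos (by exact_mod_cast hn)).ne'
  rw [Real.log_mul hC.ne' (by positivity), Real.log_pow]
  field_simp
  push_cast
  ring

lemma GKdim_le_two
    (h : ∀ V : Submodule k A, FiniteDimensional k V → ∃ C : ℕ, ∀ n : ℕ,
      Module.finrank k ↥(∑ j ∈ Finset.range (n + 1), V ^ j) ≤ C * (n + 1) ^ 2) :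
    GKdim k A ≤ 2 := by
  refine iSup₂_le fun V hV => ?_
  obtain ⟨C, hC⟩ := h V hV
  have ht := ENNReal.tendsto_ofReal
    (tendsto_log_const_mul_sq_div_log (C := (C + 1 : ℝ)) (by positivity))
  rw [show ENNReal.ofReal 2 = 2 by simp] at ht
  rw [← ht.limsup_eq]
  refine limsup_le_limsup (Eventually.of_forall fun n => ENNReal.ofReal_le_ofReal ?_)
  refine div_le_div_of_nonneg_right ?_ (Real.log_natCast_nonneg n)
  rcases Nat.eq_zero_or_pos (Module.finrank k ↥(∑ j ∈ Finset.range (n + 1), V ^ j)) with h0 | h0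
  · rw [h0, Nat.cast_zero, Real.log_zero]
    refine Real.log_nonneg ?_
    have : (1 : ℝ) ≤ (n + 1 : ℝ) ^ 2 := one_le_pow₀ (by linarith [n.cast_nonneg (α := ℝ)])
    nlinarith [C.cast_nonneg (α := ℝ)]
  · refine Real.log_le_log (by exact_mod_cast h0) ?_
    have := hC n
    calc (_ : ℝ) ≤ (C * (n + 1) ^ 2 : ℕ) := by exact_mod_cast this
      _ ≤ _ := by push_cast; nlinarith [sq_nonneg ((n : ℝ) + 1)]

lemma two_le_GKdim {V : Submodule k A} [FiniteDimensional k V] {q : ℕ} (hq : 0 < q)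
    (h : ∀ r : ℕ, r ^ 2 ≤ Module.finrank k ↥(∑ j ∈ Finset.range (q * r + 1), V ^ j)) :
    2 ≤ GKdim k A := by
  have hlog : Tendsto (fun n : ℕ => Real.log n) atTop atTop :=
    Real.tendsto_log_atTop.comp tendsto_natCast_atTop_atTop
  have hlogq : Tendsto (fun n : ℕ => Real.log q + Real.log n) atTop atTop :=
    tendsto_atTop_add_const_left _ _ hlog
  have h2 : Tendsto (fun n : ℕ => 2 - (2 * Real.log q) / (Real.log q + Real.log n)) atTop
      (𝓝 (2 - 0)) := (tendsto_const_nhds.div_atTop hlogq).const_sub 2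
  rw [sub_zero] at h2
  have h3 := ENNReal.tendsto_ofReal h2
  rw [show ENNReal.ofReal 2 = 2 by simp] at h3
  refine le_GKdim_of_tendsto (V := V) (φ := fun r => q * r)
    (tendsto_id.const_mul_atTop' hq) ?_ h3
  filter_upwards [eventually_ge_atTop 1, hlogq.eventually_gt_atTop 0] with r hr hpos
  have hq' : (q : ℝ) ≠ 0 := by positivity
  have hr' : (0 : ℝ) < r := by exact_mod_cast hr
  have e : Real.log ((q * r : ℕ) : ℝ) = Real.log q + Real.log r := by
    rw [Nat.cast_mul, Real.log_mul hq' hr'.ne']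
  rw [e, sub_div' hpos.ne', div_le_div_iff_of_pos_right hpos]
  have : Real.log ((r : ℝ) ^ 2) ≤
      Real.log (Module.finrank k ↥(∑ j ∈ Finset.range (q * r + 1), V ^ j) : ℝ) :=
    Real.log_le_log (by positivity) (by exact_mod_cast h r)
  rw [Real.log_pow] at this
  push_cast at this
  linarith

lemma GKdim_eq_top {V : Submodule k A} [FiniteDimensional k V] {q : ℕ} (hq : 0 < q)
    (h : ∀ r : ℕ, 2 ^ r ≤
      Module.finrank k ↥(∑ j ∈ Finset.range (q * (r + 1) ^ 2 + 1), V ^ j)) :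
    GKdim k A = ⊤ := by
  rw [eq_top_iff]
  have hφ : Tendsto (fun r : ℕ => q * (r + 1) ^ 2) atTop atTop :=
    tendsto_atTop_mono (fun r => show r ≤ q * (r + 1) ^ 2 by
      calc r ≤ 1 * (r + 1) ^ 2 := by nlinarith
        _ ≤ _ := Nat.mul_le_mul_right _ hq) tendsto_id
  set c : ℝ := Real.log 2 / (4 * √(2 * q)) with hc
  have hq0 : (0 : ℝ) < q := by exact_mod_cast hq
  have hlog2 : 0 < Real.log 2 := Real.log_pos one_lt_two
  have hc0 : 0 < c := by positivity
  have ht : Tendsto (fun r : ℕ => c * √(r : ℝ)) atTop atTop :=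
    (Real.tendsto_sqrt_atTop.comp tendsto_natCast_atTop_atTop).const_mul_atTop hc0
  refine le_GKdim_of_tendsto (V := V) hφ ?_ (ENNReal.tendsto_ofReal_atTop.comp ht)
  filter_upwards [eventually_ge_atTop 1] with r hr
  have hr1 : (1 : ℝ) ≤ r := by exact_mod_cast hr
  have hφ1 : (1 : ℝ) < ((q * (r + 1) ^ 2 : ℕ) : ℝ) := by
    have : 1 < q * (r + 1) ^ 2 := by nlinarith
    exact_mod_cast this
  rw [le_div_iff₀ (Real.log_pos hφ1)]
  have h1 : Real.log ((q * (r + 1) ^ 2 : ℕ) : ℝ) ≤ 4 * (√(2 * q) * √r) := by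
    have hle : ((q * (r + 1) ^ 2 : ℕ) : ℝ) ≤ (√(2 * q * r)) ^ 4 := by
      have hs : (√(2 * q * r)) ^ 4 = (2 * q * r) ^ 2 := by
        rw [show (4 : ℕ) = 2 * 2 from rfl, pow_mul, Real.sq_sqrt (by positivity)]
      have hq1 : (1 : ℝ) ≤ q := by exact_mod_cast hq
      have h4 : (r + 1 : ℝ) ^ 2 ≤ 4 * r ^ 2 := by nlinarith
      have hqq : (q : ℝ) ≤ q ^ 2 := by nlinarith
      rw [hs]
      push_cast
      calc (q : ℝ) * (r + 1) ^ 2 ≤ q ^ 2 * (4 * r ^ 2) := by gcongr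
        _ = _ := by ring
    calc _ ≤ Real.log ((√(2 * q * r)) ^ 4) := Real.log_le_log (by linarith) hle
      _ = 4 * Real.log (√(2 * q * r)) := by rw [Real.log_pow]; norm_num
      _ ≤ 4 * √(2 * q * r) := by
        gcongr
        exact Real.log_le_self (Real.sqrt_nonneg _)
      _ = _ := by rw [Real.sqrt_mul (by positivity)]
  have h2 : Real.log ((2 : ℝ) ^ r) ≤ Real.log (Module.finrank k
      ↥(∑ j ∈ Finset.range (q * (r + 1) ^ 2 + 1), V ^ j) : ℝ) :=
    Real.log_le_log (by positivity) (by exact_mod_cast h r)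
  rw [Real.log_pow] at h2
  refine le_trans ?_ h2
  calc c * √r * Real.log ((q * (r + 1) ^ 2 : ℕ) : ℝ)
      ≤ c * √r * (4 * (√(2 * q) * √r)) := by gcongr
    _ = (c * (4 * √(2 * q))) * (√r * √r) := by ring
    _ = r * Real.log 2 := by
      rw [Real.mul_self_sqrt (by positivity), hc, div_mul_cancel₀ _ (by positivity), mul_comm]

lemma map_sum_pow (φ : A →ₐ[k] B) (V : Submodule k A) (n : ℕ) :
    (∑ j ∈ Finset.range (n + 1), V ^ j).map φ.toLinearMap =
      ∑ j ∈ Finset.range (n + 1), (V.map φ.toLinearMap) ^ j := by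
  have := map_sum (Submodule.mapHom φ) (fun j => V ^ j) (Finset.range (n + 1))
  simp only [map_pow] at this
  exact this

lemma GKdim_le_of_surjective (φ : A →ₐ[k] B) (hφ : Function.Surjective φ) :
    GKdim k B ≤ GKdim k A := by
  refine iSup₂_le fun W hW => ?_
  obtain ⟨t, ht⟩ := (Submodule.fg_iff_finiteDimensional W).2 hW
  let s : Set A := Function.surjInv hφ '' t
  have hs : s.Finite := t.finite_toSet.image _
  have hV : FiniteDimensional k (Submodule.span k s) := FiniteDimensional.span_of_finite k hs
  have hmap : (Submodule.span k s).map φ.toLinearMap = W := by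
    rw [Submodule.map_span, ← ht]
    congr 1
    simp [s, Set.image_image, Function.surjInv_eq hφ]
  refine le_trans ?_ (le_iSup₂_of_le (Submodule.span k s) hV le_rfl)
  refine limsup_le_limsup (Eventually.of_forall fun n => ENNReal.ofReal_le_ofReal ?_)
  refine div_le_div_of_nonneg_right ?_ (Real.log_natCast_nonneg n)
  rw [← hmap, ← map_sum_pow]
  have := finiteDimensional_sum_pow (Submodule.span k s) n
  have hle := Submodule.finrank_map_le φ.toLinearMap
    (∑ j ∈ Finset.range (n + 1), (Submodule.span k s) ^ j)
  rcases Nat.eq_zero_or_pos (Module.finrank k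
    ↥((∑ j ∈ Finset.range (n + 1), (Submodule.span k s) ^ j).map φ.toLinearMap)) with h0 | h0
  · rw [h0, Nat.cast_zero, Real.log_zero]
    exact Real.log_natCast_nonneg _
  · exact Real.log_le_log (by exact_mod_cast h0) (by exact_mod_cast hle)

lemma GKdim_le_of_injective (φ : A →ₐ[k] B) (hφ : Function.Injective φ) :
    GKdim k A ≤ GKdim k B := by
  refine iSup₂_le fun V hV => ?_
  refine le_trans ?_ (le_iSup₂_of_le (V.map φ.toLinearMap) inferInstance le_rfl)
  refine limsup_le_limsup (Eventually.of_forall fun n => ?_)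
  beta_reduce
  rw [← map_sum_pow, ← (Submodule.equivMapOfInjective φ.toLinearMap hφ _).finrank_eq]

end GelfandKirillov

/-- An algebra generated by the points `x` of a block, with an algebra endomorphism `g` acting on
them as the block does, skew derivations `D` dual to them and the augmentation `c`. -/
structure Block (k : Type u) [Field k] (ε : k) (ℓ : ℕ) where
  A : Type u
  [ring : Ring A]
  [algebra : Algebra k A]
  g : A →ₐ[k] A
  D : Fin ℓ → A →ₗ[k] A
  c : A →ₐ[k] k
  x : Fin ℓ → A
  D_mul : ∀ i u v, D i (u * v) = D i u * g v + u * D i v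
  D_x : ∀ i j, D i (x j) = if i = j then 1 else 0
  g_x_zero : ∀ i : Fin ℓ, (i : ℕ) = 0 → g (x i) = ε • x i
  g_x_succ : ∀ i j : Fin ℓ, (j : ℕ) = i + 1 → g (x j) = ε • x j + x i
  c_x : ∀ i, c (x i) = 0
  adjoin_x : Algebra.adjoin k (Set.range x) = ⊤

attribute [instance] Block.ring Block.algebra

namespace Block

variable {k : Type u} [Field k] {ε : k} {ℓ : ℕ} (b : Block k ε ℓ)

/-- An element is zero as soon as its constant term and its skew derivatives vanish. -/
def Nondegenerate : Prop := ∀ y, b.c y = 0 → (∀ i, b.D i y = 0) → y = 0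

lemma D_one (i : Fin ℓ) : b.D i 1 = 0 := by
  have h := b.D_mul i 1 1
  simpa using h

lemma D_algebraMap (i : Fin ℓ) (r : k) : b.D i (algebraMap k b.A r) = 0 := by
  rw [Algebra.algebraMap_eq_smul_one, map_smul, D_one, smul_zero]

@[elab_as_elim]
lemma induction {P : b.A → Prop} (hr : ∀ r, P (algebraMap k b.A r)) (hx : ∀ i, P (b.x i))
    (hadd : ∀ u v, P u → P v → P (u + v)) (hmul : ∀ u v, P u → P v → P (u * v)) (y : b.A) :
    P y := by
  have hy : y ∈ Algebra.adjoin k (Set.range b.x) := by rw [b.adjoin_x]; trivial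
  induction hy using Algebra.adjoin_induction with
  | mem y hy => obtain ⟨i, rfl⟩ := hy; exact hx i
  | algebraMap r => exact hr r
  | add u v _ _ hu hv => exact hadd u v hu hv
  | mul u v _ _ hu hv => exact hmul u v hu hv

lemma g_x (i : Fin ℓ) : b.g (b.x i) = ε • b.x i + if h : (i : ℕ) = 0 then 0 else
    b.x ⟨(i : ℕ) - 1, by omega⟩ := by
  split_ifs with h
  · rw [b.g_x_zero i h, add_zero]
  · rw [b.g_x_succ ⟨(i : ℕ) - 1, by omega⟩ i (by simp; omega)]

lemma c_g (y : b.A) : b.c (b.g y) = b.c y := by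
  induction y using b.induction with
  | hr r => simp
  | hx i => rw [g_x]; split_ifs <;> simp [b.c_x]
  | hadd u v hu hv => simp [hu, hv]
  | hmul u v hu hv => simp [hu, hv]

lemma D_g_succ (i j : Fin ℓ) (hij : (j : ℕ) = i + 1) (y : b.A) :
    b.D i (b.g y) = b.g (ε • b.D i y + b.D j y) := by
  induction y using b.induction with
  | hr r => simp [D_algebraMap]
  | hx m =>
    rw [g_x]
    split_ifs with h
    · have : j ≠ m := by rintro rfl; omega
      simp [b.D_x, this, apply_ite b.g]
    · have : (i = ⟨(m : ℕ) - 1, by omega⟩) ↔ j = m := by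
        simp only [Fin.ext_iff]; omega
      simp [b.D_x, this, apply_ite b.g]
  | hadd u v hu hv => simp only [map_add, hu, hv, smul_add]; abel
  | hmul u v hu hv =>
    simp only [map_mul, b.D_mul, hu, hv, map_add, map_smul, smul_add, add_mul, mul_add,
      smul_mul_assoc, mul_smul_comm]
    abel

lemma D_g_last (i : Fin ℓ) (hi : (i : ℕ) + 1 = ℓ) (y : b.A) :
    b.D i (b.g y) = ε • b.g (b.D i y) := by
  induction y using b.induction with
  | hr r => simp [D_algebraMap]
  | hx m =>
    rw [g_x]
    split_ifs with h
    · simp [b.D_x, apply_ite b.g]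
    · have : (i ≠ ⟨(m : ℕ) - 1, by omega⟩) := by
        simp only [ne_eq, Fin.ext_iff]; omega
      simp [b.D_x, this, apply_ite b.g]
  | hadd u v hu hv => simp only [map_add, hu, hv, smul_add]
  | hmul u v hu hv =>
    simp only [map_mul, b.D_mul, hu, hv, map_add, smul_add, smul_mul_assoc,
      mul_smul_comm]

/-- The span of the points and the unit. -/
def gens : Submodule k b.A := Submodule.span k (insert 1 (Set.range b.x))

instance : FiniteDimensional k b.gens :=
  FiniteDimensional.span_of_finite k ((Set.finite_range _).insert _)

/-- The filtration by degree. -/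
def fil (n : ℕ) : Submodule k b.A := b.gens ^ n

lemma one_mem_gens : (1 : b.A) ∈ b.gens := Submodule.subset_span (Set.mem_insert _ _)

lemma x_mem_fil (i : Fin ℓ) : b.x i ∈ b.fil 1 := by
  rw [fil, pow_one]
  exact Submodule.subset_span (Set.mem_insert_of_mem _ ⟨i, rfl⟩)

variable {b}

lemma mul_mem_fil {m n p : ℕ} {u v : b.A} (hu : u ∈ b.fil m) (hv : v ∈ b.fil n)
    (h : m + n = p) : u * v ∈ b.fil p := by
  subst h
  rw [fil, pow_add]
  exact Submodule.mul_mem_mul hu hv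

variable (b) in
lemma fil_mono : Monotone b.fil := by
  refine monotone_nat_of_le_succ fun n y hy => ?_
  rw [← mul_one y]
  exact mul_mem_fil hy (by simpa [fil] using b.one_mem_gens) rfl

variable (b) in
lemma one_mem_fil (n : ℕ) : (1 : b.A) ∈ b.fil n :=
  b.fil_mono n.zero_le (by simp only [fil, pow_zero, Submodule.mem_one]; exact ⟨1, map_one _⟩)

lemma exists_of_mem_fil_zero {y : b.A} (hy : y ∈ b.fil 0) : ∃ r, y = algebraMap k b.A r := by
  rw [fil, pow_zero, Submodule.mem_one] at hy
  obtain ⟨r, hr⟩ := hy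
  exact ⟨r, hr.symm⟩

lemma eq_algebraMap_of_mem_fil_zero {y : b.A} (hy : y ∈ b.fil 0) :
    y = algebraMap k b.A (b.c y) := by
  obtain ⟨r, rfl⟩ := exists_of_mem_fil_zero hy
  simp

lemma D_fil_zero {y : b.A} (hy : y ∈ b.fil 0) (i : Fin ℓ) : b.D i y = 0 := by
  rw [eq_algebraMap_of_mem_fil_zero hy, D_algebraMap]

lemma g_fil {n : ℕ} {y : b.A} (hy : y ∈ b.fil n) : b.g y ∈ b.fil n := by
  have h1 : b.gens.map b.g.toLinearMap ≤ b.gens := by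
    rw [gens, Submodule.map_span, Submodule.span_le]
    rintro _ ⟨y, rfl | ⟨i, rfl⟩, rfl⟩
    · rw [SetLike.mem_coe, AlgHom.toLinearMap_apply, map_one]
      exact b.one_mem_gens
    · have hm : ∀ j, b.x j ∈ b.gens := fun j =>
        Submodule.subset_span (Set.mem_insert_of_mem _ ⟨j, rfl⟩)
      simp only [AlgHom.toLinearMap_apply, g_x]
      refine Submodule.add_mem _ (Submodule.smul_mem _ _ (hm i)) ?_
      split_ifs
      · exact Submodule.zero_mem _
      · exact hm _
  have h2 : (b.fil n).map b.g.toLinearMap ≤ b.fil n := by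
    rw [fil, Submodule.map_pow]
    exact pow_le_pow_left' h1 n
  exact h2 ⟨y, hy, rfl⟩

lemma D_fil {n : ℕ} {y : b.A} (hy : y ∈ b.fil (n + 1)) (i : Fin ℓ) : b.D i y ∈ b.fil n := by
  have h1 : ∀ y ∈ b.fil 1, b.D i y ∈ b.fil 0 := by
    intro y hy
    rw [fil, pow_one, gens] at hy
    induction hy using Submodule.span_induction with
    | mem y hy =>
      rcases hy with rfl | ⟨j, rfl⟩
      · rw [D_one]; exact Submodule.zero_mem _
      · rw [b.D_x]; split_ifs
        · exact b.one_mem_fil 0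
        · exact Submodule.zero_mem _
    | zero => simp
    | add u v _ _ hu hv => rw [map_add]; exact Submodule.add_mem _ hu hv
    | smul r u _ hu => rw [map_smul]; exact Submodule.smul_mem _ _ hu
  induction n generalizing y with
  | zero => exact h1 y hy
  | succ n ih =>
    rw [fil, pow_succ] at hy
    induction hy using Submodule.mul_induction_on' with
    | mem_mul_mem u hu v hv =>
      have hv' : v ∈ b.fil 1 := by simpa [fil] using hv
      rw [b.D_mul]
      exact Submodule.add_mem _ (mul_mem_fil (ih hu) (g_fil hv') rfl)
        (mul_mem_fil hu (h1 v hv') rfl)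
    | add u _ v _ hu hv => rw [map_add]; exact Submodule.add_mem _ hu hv

lemma D_pow_fil {n : ℕ} {m : ℕ} {y : b.A} (i : Fin ℓ) (hy : y ∈ b.fil (n + m)) :
    (b.D i ^ m) y ∈ b.fil n := by
  induction m generalizing y with
  | zero => simpa using hy
  | succ m ih => rw [pow_succ, Module.End.mul_apply]; exact ih (D_fil hy i)

lemma D_pow_eq_zero {n : ℕ} {m : ℕ} {y : b.A} (i : Fin ℓ) (hy : y ∈ b.fil n) (h : n < m) :
    (b.D i ^ m) y = 0 := by
  obtain ⟨t, rfl⟩ := Nat.exists_eq_add_of_lt h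
  rw [show n + t + 1 = t + 1 + n by ring, pow_add, Module.End.mul_apply, pow_succ,
    Module.End.mul_apply, D_fil_zero (D_pow_fil i (by simpa using hy)), map_zero]

variable (b) in
lemma finrank_le_of_le_fil {n : ℕ} {X : Submodule k b.A} (h : X ≤ b.fil n) :
    Module.finrank k X ≤
      Module.finrank k ↥(∑ j ∈ Finset.range (n + 1), b.gens ^ j) := by
  have : FiniteDimensional k ↥(∑ j ∈ Finset.range (n + 1), b.gens ^ j) :=
    finiteDimensional_sum_pow _ n
  exact Submodule.finrank_mono (h.trans
    (Finset.single_le_sum (f := fun j => b.gens ^ j) (fun _ _ => bot_le) (by simp)))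

end Block

namespace Block

variable {k : Type u} [Field k] {ε : k} {ℓ r : ℕ} (b : Block k ε ℓ) (e : Fin r → Fin ℓ)

/-- The elements whose iterated skew derivatives, along at most `n` indices in the range of `e`,
have no constant term. -/
def radAux : ℕ → Submodule k b.A
  | 0 => LinearMap.ker b.c.toLinearMap
  | n + 1 => LinearMap.ker b.c.toLinearMap ⊓ ⨅ i, (radAux n).comap (b.D (e i))

variable {b e}

lemma mem_radAux_succ {n : ℕ} {y : b.A} :
    y ∈ b.radAux e (n + 1) ↔ b.c y = 0 ∧ ∀ i, b.D (e i) y ∈ b.radAux e n := by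
  simp [radAux]

lemma c_of_mem_radAux {n : ℕ} {y : b.A} (h : y ∈ b.radAux e n) : b.c y = 0 := by
  cases n with
  | zero => simpa [radAux] using h
  | succ n => exact (mem_radAux_succ.1 h).1

lemma radAux_of_succ {n : ℕ} {y : b.A} (h : y ∈ b.radAux e (n + 1)) : y ∈ b.radAux e n := by
  induction n generalizing y with
  | zero => simpa [radAux] using c_of_mem_radAux h
  | succ n ih =>
    rw [mem_radAux_succ] at h ⊢
    exact ⟨h.1, fun i => ih (h.2 i)⟩

lemma D_g_cases {s : ℕ} (hs : r + s = ℓ) (he : ∀ i, (e i : ℕ) = i + s) (i : Fin r) :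
    (∃ j, ∀ y, b.D (e i) (b.g y) = b.g (ε • b.D (e i) y + b.D (e j) y)) ∨
      ∀ y, b.D (e i) (b.g y) = ε • b.g (b.D (e i) y) := by
  by_cases h : (i : ℕ) + 1 = r
  · exact .inr fun y => b.D_g_last _ (by rw [he]; omega) y
  · exact .inl ⟨⟨i + 1, by omega⟩, fun y => b.D_g_succ _ _ (by simp [he]; omega) y⟩

lemma g_mem_radAux {s : ℕ} (hs : r + s = ℓ) (he : ∀ i, (e i : ℕ) = i + s) {n : ℕ} {y : b.A}
    (h : y ∈ b.radAux e n) : b.g y ∈ b.radAux e n := by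
  induction n generalizing y with
  | zero => simpa [radAux, b.c_g] using h
  | succ n ih =>
    rw [mem_radAux_succ] at h ⊢
    refine ⟨by rw [b.c_g, h.1], fun i => ?_⟩
    rcases D_g_cases (b := b) hs he i with ⟨j, hj⟩ | hj
    · rw [hj]
      exact ih (Submodule.add_mem _ (Submodule.smul_mem _ _ (h.2 i)) (h.2 j))
    · rw [hj]
      exact Submodule.smul_mem _ _ (ih (h.2 i))

lemma mul_mem_radAux {s : ℕ} (hs : r + s = ℓ) (he : ∀ i, (e i : ℕ) = i + s) {n : ℕ} {u v : b.A}
    (h : u ∈ b.radAux e n ∨ v ∈ b.radAux e n) : u * v ∈ b.radAux e n := by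
  induction n generalizing u v with
  | zero =>
    have h : b.c u = 0 ∨ b.c v = 0 := h.imp c_of_mem_radAux c_of_mem_radAux
    simpa [radAux] using h
  | succ n ih =>
    have h0 : b.c u = 0 ∨ b.c v = 0 := h.imp c_of_mem_radAux c_of_mem_radAux
    rw [mem_radAux_succ]
    refine ⟨by simpa using h0, fun i => ?_⟩
    rw [b.D_mul]
    rcases h with h | h
    · exact Submodule.add_mem _ (ih (.inl ((mem_radAux_succ.1 h).2 i)))
        (ih (.inl (radAux_of_succ h)))
    · exact Submodule.add_mem _ (ih (.inr (g_mem_radAux hs he (radAux_of_succ h))))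
        (ih (.inr ((mem_radAux_succ.1 h).2 i)))

variable (b) in
/-- The ideal of elements all of whose iterated skew derivatives along indices in the range of `e`
have no constant term. -/
def rad {s : ℕ} (hs : r + s = ℓ) (he : ∀ i, (e i : ℕ) = i + s) : Ideal b.A where
  carrier := {y | ∀ n, y ∈ b.radAux e n}
  add_mem' hu hv n := Submodule.add_mem _ (hu n) (hv n)
  zero_mem' _ := Submodule.zero_mem _
  smul_mem' _ _ hv n := mul_mem_radAux hs he (.inr (hv n))

section

variable {s : ℕ} (hs : r + s = ℓ) (he : ∀ i, (e i : ℕ) = i + s)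

lemma mem_rad {y : b.A} : y ∈ b.rad hs he ↔ ∀ n, y ∈ b.radAux e n := Iff.rfl

lemma mem_rad_iff {y : b.A} :
    y ∈ b.rad hs he ↔ b.c y = 0 ∧ ∀ i, b.D (e i) y ∈ b.rad hs he := by
  simp only [mem_rad]
  constructor
  · exact fun h => ⟨c_of_mem_radAux (h 0), fun i n => (mem_radAux_succ.1 (h (n + 1))).2 i⟩
  · rintro ⟨h0, h⟩ (_ | n)
    · simpa [radAux] using h0
    · exact mem_radAux_succ.2 ⟨h0, fun i => h i n⟩

instance : (b.rad hs he).IsTwoSided where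
  mul_mem_of_left _ hu n := mul_mem_radAux hs he (.inl (hu n))

variable (b) in
/-- The projection to the quotient by the radical. -/
def proj : b.A →ₐ[k] b.A ⧸ b.rad hs he := Ideal.Quotient.mkₐ k _

lemma proj_surjective : Function.Surjective (b.proj hs he) := Ideal.Quotient.mkₐ_surjective k _

lemma proj_eq_zero {y : b.A} : b.proj hs he y = 0 ↔ y ∈ b.rad hs he :=
  Ideal.Quotient.eq_zero_iff_mem

lemma proj_x_eq_zero (j : Fin ℓ) (hj : (j : ℕ) < s) : b.proj hs he (b.x j) = 0 := by
  rw [proj_eq_zero, mem_rad_iff]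
  refine ⟨b.c_x j, fun i => ?_⟩
  rw [b.D_x, if_neg]
  · exact Submodule.zero_mem _
  · rintro rfl
    rw [he] at hj
    omega

/-- The block on the quotient by the radical. -/
noncomputable def quotient : Block k ε r where
  A := b.A ⧸ b.rad hs he
  g := Ideal.Quotient.liftₐ (b.rad hs he) ((b.proj hs he).comp b.g) fun y hy =>
    (proj_eq_zero hs he).2 fun n => g_mem_radAux hs he (hy n)
  D i := ((b.rad hs he).restrictScalars k).liftQ ((b.proj hs he).toLinearMap ∘ₗ b.D (e i))
    fun y hy => (proj_eq_zero hs he).2 (((mem_rad_iff hs he).1 hy).2 i)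
  c := Ideal.Quotient.liftₐ (b.rad hs he) b.c fun y hy => ((mem_rad_iff hs he).1 hy).1
  x i := b.proj hs he (b.x (e i))
  D_mul i u v := by
    obtain ⟨u, rfl⟩ := proj_surjective hs he u
    obtain ⟨v, rfl⟩ := proj_surjective hs he v
    change b.proj hs he (b.D (e i) (u * v)) = b.proj hs he (b.D (e i) u) * b.proj hs he (b.g v) +
      b.proj hs he u * b.proj hs he (b.D (e i) v)
    rw [b.D_mul, map_add, map_mul, map_mul]
  D_x i j := by
    change b.proj hs he (b.D (e i) (b.x (e j))) = _
    have : e i = e j ↔ i = j := by simp [Fin.ext_iff, he]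
    rw [b.D_x, apply_ite (b.proj hs he), map_one, map_zero]
    simp only [this]
  g_x_zero i hi := by
    change b.proj hs he (b.g (b.x (e i))) = ε • b.proj hs he (b.x (e i))
    rw [g_x, map_add, map_smul]
    split_ifs with h
    · simp
    · rw [proj_x_eq_zero hs he ⟨_, _⟩ (show (e i : ℕ) - 1 < s by rw [he] at h ⊢; omega), add_zero]
  g_x_succ i j hij := by
    change b.proj hs he (b.g (b.x (e j))) = ε • b.proj hs he (b.x (e j)) + b.proj hs he (b.x (e i))
    rw [b.g_x_succ (e i) (e j) (by rw [he, he]; omega), map_add, map_smul]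
  c_x i := b.c_x (e i)
  adjoin_x := by
    rw [eq_top_iff]
    rintro y -
    obtain ⟨y, rfl⟩ := proj_surjective hs he y
    induction y using b.induction with
    | hr t => rw [AlgHom.commutes]; exact Subalgebra.algebraMap_mem _ t
    | hx j =>
      by_cases hj : (j : ℕ) < s
      · rw [proj_x_eq_zero hs he j hj]; exact Subalgebra.zero_mem _
      · refine Algebra.subset_adjoin ⟨⟨j - s, by omega⟩, ?_⟩
        exact congrArg (fun m => b.proj hs he (b.x m)) (Fin.ext (by rw [he, Fin.val_mk]; omega))
    | hadd u v hu hv => rw [map_add]; exact Subalgebra.add_mem _ hu hv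
    | hmul u v hu hv => rw [map_mul]; exact Subalgebra.mul_mem _ hu hv

lemma quotient_nondegenerate : (b.quotient hs he).Nondegenerate := by
  intro y hc hD
  obtain ⟨y, rfl⟩ := proj_surjective hs he y
  exact (proj_eq_zero hs he).2 ((mem_rad_iff hs he).2
    ⟨hc, fun i => (proj_eq_zero hs he).1 (hD i)⟩)

end

/-- The quotient map onto a nondegenerate block that forgets the points of index `< s`. -/
structure IsTail (b : Block k ε ℓ) (b' : Block k ε r) (e : Fin r → Fin ℓ)
    (π : b.A →ₐ[k] b'.A) : Prop where
  nondegenerate : b'.Nondegenerate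
  surjective : Function.Surjective π
  map_x : ∀ i, π (b.x (e i)) = b'.x i
  map_x_eq_zero : ∀ j, (∀ i, j < e i) → π (b.x j) = 0
  map_g : ∀ y, π (b.g y) = b'.g (π y)
  map_D : ∀ i y, π (b.D (e i) y) = b'.D i (π y)
  c_map : ∀ y, b'.c (π y) = b.c y

variable (b) in
lemma exists_isTail {s : ℕ} (hr : 0 < r) (hs : r + s = ℓ) (he : ∀ i, (e i : ℕ) = i + s) :
    ∃ (b' : Block k ε r) (π : b.A →ₐ[k] b'.A), IsTail b b' e π :=
  ⟨b.quotient hs he, b.proj hs he, quotient_nondegenerate hs he, proj_surjective hs he,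
    fun _ => rfl,
    fun j hj => proj_x_eq_zero hs he j (by
      have h := he ⟨0, hr⟩
      have h' := hj ⟨0, hr⟩
      rw [Fin.lt_def] at h'
      simp only [zero_add] at h
      omega),
    fun _ => rfl, fun _ _ => rfl, fun _ => rfl⟩

end Block

namespace Block

variable {k : Type u} [Field k] {ε : k} {ℓ r : ℕ} (b : Block k ε ℓ) (h : r ≤ ℓ)

/-- The subalgebra generated by the first `r` points. -/
def subalg : Subalgebra k b.A := Algebra.adjoin k (Set.range fun i => b.x (Fin.castLE h i))

lemma x_mem_subalg (i : Fin r) : b.x (Fin.castLE h i) ∈ b.subalg h :=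
  Algebra.subset_adjoin ⟨i, rfl⟩

variable {b}

lemma g_mem_subalg {y : b.A} (hy : y ∈ b.subalg h) : b.g y ∈ b.subalg h := by
  induction hy using Algebra.adjoin_induction with
  | mem y hy =>
    obtain ⟨i, rfl⟩ := hy
    simp only [g_x, Fin.val_castLE]
    refine Subalgebra.add_mem _ (Subalgebra.smul_mem _ (b.x_mem_subalg h i) _) ?_
    split_ifs
    · exact Subalgebra.zero_mem _
    · exact b.x_mem_subalg h ⟨(i : ℕ) - 1, by omega⟩
  | algebraMap t => rw [AlgHom.commutes]; exact Subalgebra.algebraMap_mem _ t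
  | add u v _ _ hu hv => rw [map_add]; exact Subalgebra.add_mem _ hu hv
  | mul u v _ _ hu hv => rw [map_mul]; exact Subalgebra.mul_mem _ hu hv

lemma D_mem_subalg {y : b.A} (hy : y ∈ b.subalg h) (i : Fin ℓ) : b.D i y ∈ b.subalg h := by
  induction hy using Algebra.adjoin_induction with
  | mem y hy =>
    obtain ⟨j, rfl⟩ := hy
    simp only [b.D_x]
    split_ifs
    · exact Subalgebra.one_mem _
    · exact Subalgebra.zero_mem _
  | algebraMap t => rw [D_algebraMap]; exact Subalgebra.zero_mem _
  | add u v _ _ hu hv => rw [map_add]; exact Subalgebra.add_mem _ hu hv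
  | mul u v hu' hv' hu hv =>
    rw [b.D_mul]
    exact Subalgebra.add_mem _ (Subalgebra.mul_mem _ hu (g_mem_subalg h hv'))
      (Subalgebra.mul_mem _ hu' hv)

lemma D_eq_zero_of_mem_subalg {y : b.A} (hy : y ∈ b.subalg h) (i : Fin ℓ) (hi : r ≤ i) :
    b.D i y = 0 := by
  induction hy using Algebra.adjoin_induction with
  | mem y hy =>
    obtain ⟨j, rfl⟩ := hy
    rw [b.D_x, if_neg]
    rintro rfl
    simp at hi
    omega
  | algebraMap t => exact b.D_algebraMap i t
  | add u v _ _ hu hv => rw [map_add, hu, hv, add_zero]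
  | mul u v hu' hv' hu hv => rw [b.D_mul, hu, hv, zero_mul, mul_zero, add_zero]

variable (b)

/-- The block spanned by the first `r` points. -/
def sub : Block k ε r where
  A := b.subalg h
  g := (b.g.comp (b.subalg h).val).codRestrict _ fun y => g_mem_subalg h y.2
  D i := (b.D (Fin.castLE h i)).restrict (p := Subalgebra.toSubmodule (b.subalg h))
    (q := Subalgebra.toSubmodule (b.subalg h)) fun y hy => D_mem_subalg h hy _
  c := b.c.comp (b.subalg h).val
  x i := ⟨b.x (Fin.castLE h i), b.x_mem_subalg h i⟩
  D_mul i u v := Subtype.ext (b.D_mul _ _ _)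
  D_x i j := by
    refine Subtype.ext ((b.D_x _ _).trans ?_)
    have : Fin.castLE h i = Fin.castLE h j ↔ i = j := by simp [Fin.ext_iff]
    simp only [this]
    split_ifs <;> rfl
  g_x_zero i hi := Subtype.ext (b.g_x_zero _ hi)
  g_x_succ i j hij := Subtype.ext (b.g_x_succ _ _ hij)
  c_x i := b.c_x _
  adjoin_x := by
    rw [eq_top_iff]
    rintro ⟨y, hy⟩ -
    induction hy using Algebra.adjoin_induction with
    | mem y hy =>
      obtain ⟨j, rfl⟩ := hy
      exact Algebra.subset_adjoin ⟨j, rfl⟩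
    | algebraMap t => exact Subalgebra.algebraMap_mem _ t
    | add u v _ _ hu hv => exact Subalgebra.add_mem _ hu hv
    | mul u v _ _ hu hv => exact Subalgebra.mul_mem _ hu hv

variable {b} in
lemma Nondegenerate.sub (hb : b.Nondegenerate) : (b.sub h).Nondegenerate := by
  intro y hc hD
  refine Subtype.ext (hb y.1 hc fun i => ?_)
  by_cases hi : (i : ℕ) < r
  · exact congrArg Subtype.val (hD ⟨i, hi⟩)
  · exact D_eq_zero_of_mem_subalg h y.2 i (not_lt.1 hi)

lemma GKdim_sub_le : GKdim k (b.sub h).A ≤ GKdim k b.A :=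
  GKdim_le_of_injective (b.subalg h).val Subtype.val_injective

section Free

variable (D : Fin ℓ → (FreeAlgebra k (Fin ℓ) →ₗ[k] FreeAlgebra k (Fin ℓ)))
  (hDx : ∀ i j, D i (FreeAlgebra.ι k j) = if i = j then 1 else 0)
  (hDmul : ∀ i (u v : FreeAlgebra k (Fin ℓ)),
    D i (u * v) = D i u * blockAut k ℓ ε v + u * D i v)

/-- The free algebra as a block. -/
noncomputable def free : Block k ε ℓ where
  A := FreeAlgebra k (Fin ℓ)
  g := blockAut k ℓ ε
  D := D
  c := FreeAlgebra.lift k 0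
  x := FreeAlgebra.ι k
  D_mul := hDmul
  D_x := hDx
  g_x_zero i hi := by simp [blockAut, hi]
  g_x_succ i j hij := by simp [blockAut, hij]
  c_x i := by simp
  adjoin_x := FreeAlgebra.adjoin_range_ι k (Fin ℓ)

lemma blockAut_mem_degComp {n : ℕ} {y : FreeAlgebra k (Fin ℓ)} (hy : y ∈ degComp k ℓ n) :
    blockAut k ℓ ε y ∈ degComp k ℓ n := by
  have h1 : (Submodule.span k (Set.range (FreeAlgebra.ι k : Fin ℓ → _))).map
      (blockAut k ℓ ε).toLinearMap ≤ Submodule.span k (Set.range (FreeAlgebra.ι k)) := by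
    rw [Submodule.map_span, Submodule.span_le]
    rintro _ ⟨_, ⟨i, rfl⟩, rfl⟩
    simp only [blockAut, AlgHom.toLinearMap_apply, FreeAlgebra.lift_ι_apply, SetLike.mem_coe]
    refine Submodule.add_mem _ (Submodule.smul_mem _ _ (Submodule.subset_span ⟨i, rfl⟩)) ?_
    split_ifs
    · exact Submodule.zero_mem _
    · exact Submodule.subset_span ⟨_, rfl⟩
  have h2 : (degComp k ℓ n).map (blockAut k ℓ ε).toLinearMap ≤ degComp k ℓ n := by
    rw [degComp, Submodule.map_pow]
    exact pow_le_pow_left' h1 n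
  exact h2 ⟨y, hy, rfl⟩

include hDx hDmul in
lemma D_mem_degComp {n : ℕ} {y : FreeAlgebra k (Fin ℓ)} (hy : y ∈ degComp k ℓ (n + 1))
    (i : Fin ℓ) : D i y ∈ degComp k ℓ n := by
  have h1 : ∀ y ∈ degComp k ℓ 1, D i y ∈ degComp k ℓ 0 := by
    intro y hy
    rw [degComp, pow_one] at hy
    rw [degComp, pow_zero]
    induction hy using Submodule.span_induction with
    | mem y hy =>
      obtain ⟨j, rfl⟩ := hy
      rw [hDx]
      split_ifs
      · exact Submodule.mem_one.2 ⟨1, map_one _⟩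
      · exact Submodule.zero_mem _
    | zero => simp
    | add u v _ _ hu hv => rw [map_add]; exact Submodule.add_mem _ hu hv
    | smul r u _ hu => rw [map_smul]; exact Submodule.smul_mem _ _ hu
  induction n generalizing y with
  | zero => exact h1 y hy
  | succ n ih =>
    rw [degComp, pow_succ] at hy
    induction hy using Submodule.mul_induction_on' with
    | mem_mul_mem u hu v hv =>
      have hv' : v ∈ degComp k ℓ 1 := by simpa [degComp] using hv
      rw [hDmul]
      refine Submodule.add_mem _ ?_ ?_
      · have := Submodule.mul_mem_mul (ih hu) (blockAut_mem_degComp (ε := ε) hv')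
        rwa [degComp, degComp, ← pow_add] at this
      · have := Submodule.mul_mem_mul hu (h1 v hv')
        rwa [degComp, ← pow_add] at this
    | add u _ v _ hu hv => rw [map_add]; exact Submodule.add_mem _ hu hv

lemma lift_zero_of_mem_degComp {n : ℕ} {y : FreeAlgebra k (Fin ℓ)}
    (hy : y ∈ degComp k ℓ (n + 1)) : FreeAlgebra.lift k (0 : Fin ℓ → k) y = 0 := by
  rw [degComp, pow_succ] at hy
  induction hy using Submodule.mul_induction_on' with
  | mem_mul_mem u hu v hv =>
    rw [map_mul]
    have : Submodule.span k (Set.range (FreeAlgebra.ι k : Fin ℓ → _)) ≤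
        LinearMap.ker (FreeAlgebra.lift k (0 : Fin ℓ → k)).toLinearMap := by
      rw [Submodule.span_le]
      rintro _ ⟨i, rfl⟩
      simp
    rw [show FreeAlgebra.lift k (0 : Fin ℓ → k) v = 0 from this hv, mul_zero]
  | add u _ v _ hu hv => rw [map_add, hu, hv, add_zero]

lemma nicholsSet_subset : ∀ y ∈ nicholsSet D,
    y ∈ (free D hDx hDmul).rad (e := id) (add_zero ℓ) fun _ => rfl := by
  rintro y ⟨n, -, hy, hl⟩
  induction n generalizing y with
  | zero =>
    have : y = 0 := hl [] rfl
    exact this ▸ Submodule.zero_mem _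
  | succ n ih =>
    refine (mem_rad_iff (b := free D hDx hDmul) _ _).2
      ⟨lift_zero_of_mem_degComp hy, fun i => ih (D i y) (D_mem_degComp D hDx hDmul hy i) ?_⟩
    intro l h
    simpa using hl (l ++ [i]) (by simpa using h)

include hDx hDmul in
theorem exists_nondegenerate (hr : r ≤ ℓ) : ∃ b : Block k ε r, b.Nondegenerate ∧
    GKdim k b.A ≤ GKdim k (RingQuot (nicholsRel D)) := by
  let b := (free D hDx hDmul).quotient (e := id) (add_zero ℓ) fun _ => rfl
  refine ⟨b.sub hr, (quotient_nondegenerate _ _).sub hr, (GKdim_sub_le b hr).trans ?_⟩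
  let φ : FreeAlgebra k (Fin ℓ) →ₐ[k] b.A :=
    (free D hDx hDmul).proj (e := id) (add_zero ℓ) fun _ => rfl
  refine GKdim_le_of_surjective (RingQuot.liftAlgHom k ⟨φ, ?_⟩) ?_
  · rintro x _ ⟨hx, rfl⟩
    rw [map_zero]
    exact (proj_eq_zero _ _).2 (nicholsSet_subset D hDx hDmul x hx)
  · intro y
    obtain ⟨y, rfl⟩ := proj_surjective _ _ y
    exact ⟨RingQuot.mkAlgHom k _ y,
      RingQuot.liftAlgHom_mkAlgHom_apply (A := FreeAlgebra k (Fin ℓ)) k φ _ y⟩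

end Free

end Block

namespace Block

variable {k : Type u} [Field k] {ε : k} {ℓ : ℕ} {b : Block k ε ℓ}

/-- The span of the products of `r` elements among `z 0, …, z (m - 1)`, with increasing indices. -/
def chain (z : ℕ → b.A) : ℕ → ℕ → Submodule k b.A
  | 0, 0 => Submodule.span k {1}
  | 0, _ + 1 => ⊥
  | m + 1, 0 => chain z m 0
  | m + 1, r + 1 => chain z m (r + 1) ⊔ (chain z m r).map (LinearMap.mulRight k (z m))

variable {z : ℕ → b.A}

lemma chain_zero_right (m : ℕ) : chain z m 0 = Submodule.span k {1} := by
  induction m with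
  | zero => rfl
  | succ m ih => rw [chain, ih]

lemma mem_chain_succ {m r : ℕ} {y : b.A} :
    y ∈ chain z (m + 1) (r + 1) ↔ ∃ u ∈ chain z m (r + 1), ∃ v ∈ chain z m r, u + v * z m = y := by
  rw [chain, Submodule.mem_sup]
  simp

lemma chain_induction {P : ℕ → ℕ → b.A → Prop} (hone : ∀ m (t : k), P m 0 (t • 1))
    (hzero : ∀ m r, P m r 0) (hadd : ∀ m r u v, P m (r + 1) u → P m r v →
      v ∈ chain z m r → P (m + 1) (r + 1) (u + v * z m)) {m r : ℕ} {y : b.A}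
    (hy : y ∈ chain z m r) : P m r y := by
  induction m generalizing r y with
  | zero =>
    cases r with
    | zero =>
      obtain ⟨t, rfl⟩ := Submodule.mem_span_singleton.1 hy
      exact hone 0 t
    | succ r => rw [(Submodule.mem_bot k).1 hy]; exact hzero _ _
  | succ m ih =>
    cases r with
    | zero =>
      rw [chain_zero_right] at hy
      obtain ⟨t, rfl⟩ := Submodule.mem_span_singleton.1 hy
      exact hone _ t
    | succ r =>
      obtain ⟨u, hu, v, hv, rfl⟩ := mem_chain_succ.1 hy
      exact hadd m r u v (ih hu) (ih hv) hv

lemma mem_fil_of_mem_chain {C : ℕ} (hz : ∀ m, z m ∈ b.fil (C * (m + 1))) {m r : ℕ} {y : b.A}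
    (hy : y ∈ chain z m r) : y ∈ b.fil (r * (C * m)) := by
  refine chain_induction (P := fun m r y => y ∈ b.fil (r * (C * m)))
    (fun m t => Submodule.smul_mem _ _ (b.one_mem_fil _)) (fun m r => Submodule.zero_mem _)
    (fun m r u v hu hv _ => Submodule.add_mem _ (b.fil_mono ?_ hu)
      (b.fil_mono ?_ (mul_mem_fil hv (hz m) rfl))) hy
  · gcongr; omega
  · have : r * (C * m) ≤ r * (C * (m + 1)) := by gcongr; omega
    linarith [this]

section Criterion

variable {W : ℕ → Submodule k b.A} {Δ : ℕ → Module.End k b.A} {γ : ℕ → k}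
  (hγ : ∀ m, γ m ≠ 0) (h1 : (1 : b.A) ∉ W 0) (hW : ∀ m r, ∀ y ∈ W (r + 1), Δ m y ∈ W r)
  (hX : ∀ m r, ∀ y ∈ chain z m (r + 1), Δ m y ∈ W r)
  (hXz : ∀ m r, ∀ y ∈ chain z m r, Δ m (y * z m) - γ m • y ∈ W r)

include hγ hW hX hXz in
lemma chain_right_mem {m r : ℕ} {u v : b.A} (hu : u ∈ chain z m (r + 1)) (hv : v ∈ chain z m r)
    (h : u + v * z m ∈ W (r + 1)) : v ∈ W r := by
  have h' := Submodule.sub_mem _ (hW m r _ h) (hX m r u hu)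
  rw [map_add, add_sub_cancel_left] at h'
  have h'' := Submodule.sub_mem _ h' (hXz m r v hv)
  rw [sub_sub_cancel] at h''
  exact (Submodule.smul_mem_iff _ (hγ m)).1 h''

include hγ h1 hW hX hXz in
lemma eq_zero_of_mem_chain {m r : ℕ} {y : b.A} (hy : y ∈ chain z m r) (hyW : y ∈ W r) : y = 0 := by
  have hone : ∀ t : k, t • (1 : b.A) ∈ W 0 → t • (1 : b.A) = 0 := by
    intro t ht
    by_cases h0 : t = 0
    · rw [h0, zero_smul]
    · exact absurd ((Submodule.smul_mem_iff _ h0).1 ht) h1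
  induction m generalizing r y with
  | zero =>
    cases r with
    | zero =>
      obtain ⟨t, rfl⟩ := Submodule.mem_span_singleton.1 hy
      exact hone t hyW
    | succ r => exact (Submodule.mem_bot k).1 hy
  | succ m ih =>
    cases r with
    | zero =>
      rw [chain_zero_right] at hy
      obtain ⟨t, rfl⟩ := Submodule.mem_span_singleton.1 hy
      exact hone t hyW
    | succ r =>
      obtain ⟨u, hu, v, hv, rfl⟩ := mem_chain_succ.1 hy
      have hv0 : v = 0 := ih hv (chain_right_mem hγ hW hX hXz hu hv hyW)
      rw [hv0, zero_mul, add_zero] at hyW ⊢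
      exact ih hu hyW

instance finiteDimensional_chain (m r : ℕ) : FiniteDimensional k (chain z m r) := by
  induction m generalizing r with
  | zero => cases r <;> (rw [chain]; infer_instance)
  | succ m ih =>
    cases r with
    | zero => rw [chain]; exact ih 0
    | succ r =>
      have := ih r
      have := ih (r + 1)
      rw [chain]; infer_instance

include hγ h1 hW hX hXz in
lemma choose_le_finrank_chain (m r : ℕ) : m.choose r ≤ Module.finrank k (chain z m r) := by
  have hne : (1 : b.A) ≠ 0 := fun h => h1 (h ▸ Submodule.zero_mem _)
  induction m generalizing r with
  | zero =>
    cases r with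
    | zero => rw [chain, finrank_span_singleton hne, Nat.choose_self]
    | succ r => simp
  | succ m ih =>
    cases r with
    | zero => rw [chain_zero_right, finrank_span_singleton hne, Nat.choose_zero_right]
    | succ r =>
      have hv0 : ∀ u ∈ chain z m (r + 1), ∀ v ∈ chain z m r, u + v * z m = 0 → v = 0 := by
        intro u hu v hv h
        exact eq_zero_of_mem_chain hγ h1 hW hX hXz hv
          (chain_right_mem hγ hW hX hXz hu hv (h ▸ Submodule.zero_mem _))
      have hinf : chain z m (r + 1) ⊓ (chain z m r).map (LinearMap.mulRight k (z m)) = ⊥ := by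
        rw [eq_bot_iff]
        rintro _ ⟨hy, v, hv, rfl⟩
        have := hv0 _ hy (-v) (Submodule.neg_mem _ hv) (by simp)
        rw [neg_eq_zero] at this
        simp [this]
      have hinj : Module.finrank k ((chain z m r).map (LinearMap.mulRight k (z m))) =
          Module.finrank k (chain z m r) := by
        rw [← LinearMap.range_domRestrict]
        refine LinearMap.finrank_range_of_inj ((injective_iff_map_eq_zero _).2 ?_)
        rintro ⟨v, hv⟩ h
        exact Subtype.ext (hv0 0 (Submodule.zero_mem _) v hv (by simpa using h))
      have hsum := Submodule.finrank_sup_add_finrank_inf_eq (chain z m (r + 1))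
        ((chain z m r).map (LinearMap.mulRight k (z m)))
      rw [hinf, finrank_bot, add_zero, hinj] at hsum
      rw [chain, hsum, Nat.choose_succ_succ, add_comm]
      exact add_le_add (ih _) (ih _)

include hγ h1 hW hX hXz in
theorem GKdim_eq_top_of_chain {C : ℕ} (hz : ∀ m, z m ∈ b.fil (C * (m + 1))) :
    GKdim k b.A = ⊤ := by
  refine GKdim_eq_top (V := b.gens) (q := 2 * C + 1) (by omega) fun r => ?_
  have hpow : ∀ r, 2 ^ r ≤ (2 * r).choose r := by
    intro r
    rw [← Nat.centralBinom_eq_two_mul_choose]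
    induction r with
    | zero => simp
    | succ r ih =>
      refine Nat.le_of_mul_le_mul_left ?_ r.succ_pos
      rw [Nat.succ_eq_add_one, Nat.succ_mul_centralBinom_succ, pow_succ]
      nlinarith [Nat.zero_le (r * r.centralBinom)]
  refine (hpow r).trans ((choose_le_finrank_chain hγ h1 hW hX hXz (2 * r) r).trans
    (b.finrank_le_of_le_fil fun y hy => b.fil_mono ?_ (mem_fil_of_mem_chain hz hy)))
  nlinarith [Nat.zero_le (C * r), Nat.zero_le C]

end Criterion

end Block

namespace Block

variable {k : Type u} [Field k] {ε : k} {r : ℕ} (b : Block k ε (r + 2))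

/-- The iterated braided commutators of the last point with the first one. -/
def adPow : ℕ → b.A
  | 0 => b.x 0
  | n + 1 => b.x (Fin.last _) * adPow n - b.g (adPow n) * b.x (Fin.last _)

variable {b}

lemma D_g_eq_zero {i : Fin (r + 2)} {y : b.A} (h : ∀ j, i ≤ j → b.D j y = 0) :
    b.D i (b.g y) = 0 := by
  by_cases hi : (i : ℕ) + 1 = r + 2
  · rw [b.D_g_last i hi, h i le_rfl, map_zero, smul_zero]
  · rw [b.D_g_succ i ⟨i + 1, by omega⟩ rfl, h i le_rfl, h _ (by rw [Fin.le_def]; simp), smul_zero,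
      add_zero, map_zero]

lemma D_succ_g_eq_zero {y : b.A} (h : ∀ i : Fin (r + 1), b.D i.succ y = 0) (i : Fin (r + 1)) :
    b.D i.succ (b.g y) = 0 :=
  D_g_eq_zero fun j hj => by
    obtain ⟨j, rfl⟩ := Fin.exists_succ_eq.2 (show j ≠ 0 by rintro rfl; simp at hj)
    exact h j

lemma D_succ_adPow (n : ℕ) (i : Fin (r + 1)) : b.D i.succ (b.adPow n) = 0 := by
  induction n generalizing i with
  | zero => rw [adPow, b.D_x, if_neg (Fin.succ_ne_zero i)]
  | succ n ih =>
    rw [adPow, map_sub, b.D_mul, b.D_mul, ih, D_succ_g_eq_zero ih, b.D_x]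
    split_ifs <;> simp

lemma D_zero_adPow_succ (n : ℕ) : b.D 0 (b.adPow (n + 1)) =
    b.x (Fin.last _) * b.D 0 (b.adPow n) - ε • b.g (b.D 0 (b.adPow n) * b.x (Fin.last _)) := by
  have h : b.D 1 (b.adPow n) = 0 := D_succ_adPow n 0
  have hl : (0 : Fin (r + 2)) ≠ Fin.last _ := by simp [Fin.ext_iff]
  rw [adPow, map_sub, b.D_mul, b.D_mul, b.D_x, if_neg hl, b.D_g_succ 0 1 (by simp), h]
  simp

lemma adPow_mem_fil (n : ℕ) : b.adPow n ∈ b.fil (n + 1) := by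
  induction n with
  | zero => exact b.x_mem_fil 0
  | succ n ih =>
    exact Submodule.sub_mem _ (mul_mem_fil (b.x_mem_fil _) ih (by omega))
      (mul_mem_fil (g_fil ih) (b.x_mem_fil _) rfl)

lemma D_one_pow_mul {u v : b.A} (hv : ∀ i : Fin (r + 1), b.D i.succ v = 0) (n : ℕ) :
    (b.D 1 ^ n) (u * v) = (b.D 1 ^ n) u * (b.g ^ n) v := by
  induction n generalizing u v with
  | zero => simp
  | succ n ih =>
    have h : b.D 1 v = 0 := hv 0
    rw [pow_succ, Module.End.mul_apply, b.D_mul, h, mul_zero, add_zero, ih (D_succ_g_eq_zero hv)]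
    rfl

lemma D_one_pow_mul_left {u v : b.A} (hu : b.D 1 u = 0) (n : ℕ) :
    (b.D 1 ^ n) (u * v) = u * (b.D 1 ^ n) v := by
  induction n generalizing v with
  | zero => simp
  | succ n ih =>
    rw [pow_succ, Module.End.mul_apply, b.D_mul, hu, zero_mul, zero_add, ih, Module.End.mul_apply]

lemma D_succ_of_mem_chain {z : ℕ → b.A} (hz : ∀ m (i : Fin (r + 1)), b.D i.succ (z m) = 0)
    {m t : ℕ} {y : b.A} (hy : y ∈ chain z m t) (i : Fin (r + 1)) : b.D i.succ y = 0 := by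
  refine chain_induction (P := fun _ _ y => b.D i.succ y = 0) ?_ ?_ ?_ hy
  · intro m t
    rw [map_smul, D_one, smul_zero]
  · intro m t
    exact map_zero _
  · intro m t u v hu hv _
    rw [map_add, b.D_mul, hu, hv, hz, zero_mul, mul_zero, add_zero, add_zero]

lemma D_one_pow_D_zero_of_mem_chain {s : ℕ} (hs : 0 < s) {m t : ℕ} {y : b.A}
    (hy : y ∈ chain (fun m => b.adPow (s * m)) m t) {n : ℕ} (hn : s * m ≤ n) :
    (b.D 1 ^ n) (b.D 0 y) = 0 := by
  revert n
  refine chain_induction (P := fun m _ y => ∀ {n}, s * m ≤ n → (b.D 1 ^ n) (b.D 0 y) = 0)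
    ?_ ?_ ?_ hy
  · intro m t n _
    rw [map_smul, D_one, smul_zero, map_zero]
  · intro m t n _
    rw [map_zero, map_zero]
  · intro m t u v hu hv hvc n hn
    have hn' : s * m < n := by rw [mul_add] at hn; omega
    have hv1 : b.D 1 v = 0 := D_succ_of_mem_chain (fun m => D_succ_adPow _) hvc 0
    rw [map_add, map_add, hu hn'.le, b.D_mul, map_add,
      D_one_pow_mul (D_succ_g_eq_zero (D_succ_adPow _)), D_one_pow_mul_left hv1, hv hn'.le,
      D_pow_eq_zero 1 (D_fil (adPow_mem_fil (s * m)) 0) hn']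
    simp

/-- Infinite Gelfand–Kirillov dimension is detected by the coefficients computed in the block
without the first point. -/
theorem GKdim_eq_top_of_tail (s : ℕ) (hs : 0 < s)
    (h : ∀ b' : Block k ε (r + 1), b'.Nondegenerate → ∀ β : ℕ → b'.A, β 0 = 1 →
      (∀ n, β (n + 1) =
        b'.x (Fin.last _) * β n - ε • b'.g (β n * b'.x (Fin.last _))) →
      ∀ m, b'.c ((b'.D 0 ^ (s * m)) (β (s * m))) ≠ 0) : GKdim k b.A = ⊤ := by
  obtain ⟨b', π, hπ⟩ := b.exists_isTail (e := Fin.succ) (s := 1) r.succ_pos rfl (by simp)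
  set z : ℕ → b.A := fun m => b.adPow (s * m)
  have hz : ∀ m (i : Fin (r + 1)), b.D i.succ (z m) = 0 := fun m => D_succ_adPow _
  have hβ := h b' hπ.nondegenerate (fun n => π (b.D 0 (b.adPow n))) (by simp [adPow, b.D_x])
    (fun n => by
      rw [D_zero_adPow_succ, map_sub, map_smul, hπ.map_g, map_mul, map_mul, ← hπ.map_x]
      simp)
  have hfil : ∀ n, b.D 0 (b.adPow n) ∈ b.fil n := fun n => D_fil (adPow_mem_fil n) 0
  have hπD : ∀ n y, π ((b.D 1 ^ n) y) = (b'.D 0 ^ n) (π y) := by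
    intro n y
    induction n generalizing y with
    | zero => simp
    | succ n ih =>
      rw [pow_succ, Module.End.mul_apply, ih, pow_succ, Module.End.mul_apply, ← hπ.map_D]
      simp
  have hγ : ∀ m, (b.D 1 ^ (s * m)) (b.D 0 (z m)) =
      algebraMap k b.A (b'.c ((b'.D 0 ^ (s * m)) (π (b.D 0 (z m))))) := by
    intro m
    rw [← hπD, hπ.c_map]
    exact eq_algebraMap_of_mem_fil_zero (D_pow_fil (n := 0) 1 (by simpa using hfil (s * m)))
  refine GKdim_eq_top_of_chain (z := z) (W := fun _ => ⊥)
    (Δ := fun m => b.D 1 ^ (s * m) * b.D 0) (C := s) hβ ?_ ?_ ?_ ?_ ?_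
  · intro h1
    have h1 : (1 : b.A) = 0 := h1
    simpa using congrArg b.c h1
  · intro m t y hy
    rw [(Submodule.mem_bot k).1 hy, map_zero]
    exact Submodule.zero_mem _
  · intro m t y hy
    refine (Submodule.mem_bot k).2 ?_
    rw [Module.End.mul_apply, D_one_pow_D_zero_of_mem_chain hs hy le_rfl]
  · intro m t y hy
    have hy1 : b.D 1 y = 0 := D_succ_of_mem_chain hz hy 0
    refine (Submodule.mem_bot k).2 ?_
    rw [Module.End.mul_apply, b.D_mul, map_add, D_one_pow_mul (D_succ_g_eq_zero (hz m)),
      D_one_pow_mul_left hy1, D_one_pow_D_zero_of_mem_chain hs hy le_rfl, hγ, zero_mul, zero_add,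
      Algebra.algebraMap_eq_smul_one, mul_smul_comm, mul_one, sub_self]
  · intro m
    exact b.fil_mono (by rw [mul_add]; omega) (adPow_mem_fil (s * m))

end Block

namespace Block

section Powers

variable {k : Type u} [Field k] {ε : k} {ℓ : ℕ} {b : Block k ε (ℓ + 1)}

variable (b) in
lemma g_x0 : b.g (b.x 0) = ε • b.x 0 := b.g_x_zero 0 rfl

variable (b) in
lemma g_x0_pow (n : ℕ) : b.g (b.x 0 ^ n) = ε ^ n • b.x 0 ^ n := by
  rw [map_pow, g_x0, smul_pow]

variable (b) in
lemma D_x0_pow_succ (n : ℕ) :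
    b.D 0 (b.x 0 ^ (n + 1)) = (∑ i ∈ Finset.range (n + 1), ε ^ i) • b.x 0 ^ n := by
  induction n with
  | zero => simp [b.D_x]
  | succ n ih =>
    rw [pow_succ, b.D_mul, ih, b.D_x, if_pos rfl, g_x0, Finset.sum_range_succ' _ (n + 1)]
    simp only [smul_mul_smul_comm, ← pow_succ, mul_one, pow_zero, add_smul, one_smul,
      Finset.sum_mul]

variable (b) in
lemma D_pow_x0_pow (n : ℕ) : (b.D 0 ^ n) (b.x 0 ^ n) =
    (∏ j ∈ Finset.range n, ∑ i ∈ Finset.range (j + 1), ε ^ i) • 1 := by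
  induction n with
  | zero => simp
  | succ n ih =>
    rw [pow_succ (b.D 0), Module.End.mul_apply, D_x0_pow_succ, map_smul, ih, smul_smul,
      Finset.prod_range_succ, mul_comm]

variable (b) in
lemma D_succ_x0_pow (n : ℕ) (i : Fin ℓ) : b.D i.succ (b.x 0 ^ n) = 0 := by
  induction n with
  | zero => simp [D_one]
  | succ n ih => rw [pow_succ, b.D_mul, ih, b.D_x, if_neg (Fin.succ_ne_zero i)]; simp

end Powers

variable {k : Type u} [Field k]

theorem GKdim_eq_top_of_pow_ne_one {ε : k} (b : Block k ε 2) (hε : ∀ n, 0 < n → ε ^ n ≠ 1) :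
    GKdim k b.A = ⊤ := by
  refine b.GKdim_eq_top_of_tail 1 one_pos fun b' _ β h0 h1 m => ?_
  have hβ : ∀ n, β n = (∏ j ∈ Finset.range n, (1 - ε ^ (j + 2))) • b'.x 0 ^ n := by
    intro n
    induction n with
    | zero => simpa using h0
    | succ n ih =>
      rw [h1, ih, Finset.prod_range_succ, Fin.last_zero, smul_mul_assoc, map_smul, ← pow_succ,
        g_x0_pow, mul_smul_comm, ← pow_succ']
      module
  have hsum : ∀ n, ∑ i ∈ Finset.range (n + 1), ε ^ i ≠ 0 := by
    intro n h
    refine hε (n + 1) n.succ_pos (sub_eq_zero.1 ?_)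
    rw [← geom_sum_mul, h, zero_mul]
  rw [one_mul, hβ, map_smul, D_pow_x0_pow, map_smul, map_smul, map_one]
  simp only [smul_eq_mul, mul_one]
  refine mul_ne_zero (Finset.prod_ne_zero_iff.2 fun j _ => sub_ne_zero.2 (hε _ (by omega)).symm)
    (Finset.prod_ne_zero_iff.2 fun j _ => hsum j)

section Jordan

variable {b : Block k 1 2} (hb : b.Nondegenerate) [CharZero k]

include hb in
lemma jordan_rel : b.x 1 * b.x 0 = b.x 0 * b.x 1 - (1 / 2 : k) • b.x 0 ^ 2 := by
  have h2 : (2 : k) ≠ 0 := two_ne_zero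
  have hg : b.g (b.x 1) = b.x 1 + b.x 0 := by rw [b.g_x_succ 0 1 rfl, one_smul]
  rw [← sub_eq_zero]
  refine hb _ (by simp [b.c_x]) fun i => ?_
  fin_cases i
  · simp [b.D_mul, b.D_x, pow_two, hg, g_x0, ← two_smul k (b.x 0), smul_smul, h2]
  · simp [b.D_mul, b.D_x, pow_two, hg, g_x0]

include hb in
lemma jordan_rel_pow (n : ℕ) :
    b.x 1 * b.x 0 ^ n = b.x 0 ^ n * b.x 1 - (n / 2 : k) • b.x 0 ^ (n + 1) := by
  induction n with
  | zero => simp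
  | succ n ih =>
    rw [pow_succ, ← mul_assoc, ih, sub_mul, mul_assoc, jordan_rel hb, mul_sub, ← mul_assoc,
      mul_smul_comm, smul_mul_assoc, ← pow_succ, ← pow_succ, ← pow_add]
    push_cast
    module

end Jordan

theorem GKdim_eq_top_of_one [CharZero k] (b : Block k 1 3) : GKdim k b.A = ⊤ := by
  refine b.GKdim_eq_top_of_tail 1 one_pos fun b' hb β h0 h1 m => ?_
  have hβ : ∀ n, β n = (∏ j ∈ Finset.range n, (-(j / 2 : k) - 1)) • b'.x 0 ^ n := by
    intro n
    induction n with
    | zero => simpa using h0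
    | succ n ih =>
      have hg : b'.g (b'.x 1) = b'.x 1 + b'.x 0 := by rw [b'.g_x_succ 0 1 rfl, one_smul]
      rw [h1, ih, Finset.prod_range_succ, show Fin.last 1 = 1 from rfl, smul_mul_assoc, map_smul,
        map_mul, g_x0_pow, hg, mul_smul_comm, jordan_rel_pow hb, one_pow, one_smul, one_smul,
        mul_add, ← pow_succ]
      module
  rw [one_mul, hβ, map_smul, D_pow_x0_pow, map_smul, map_smul, map_one]
  simp only [smul_eq_mul, mul_one]
  refine mul_ne_zero (Finset.prod_ne_zero_iff.2 fun j _ => ?_)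
    (Finset.prod_ne_zero_iff.2 fun j _ => ?_)
  · have : -((j : k) / 2) - 1 = -((j + 2 : ℕ) / 2 : k) := by push_cast; ring
    rw [this, neg_ne_zero]
    exact div_ne_zero (Nat.cast_ne_zero.2 (by omega)) two_ne_zero
  · simpa using Nat.cast_add_one_ne_zero j

section SuperJordan

variable {b : Block k (-1) 2} (hb : b.Nondegenerate)

variable (b) in
/-- The anticommutator of the two points. -/
def anti : b.A := b.x 1 * b.x 0 + b.x 0 * b.x 1

variable (b) in
lemma g_x1_neg : b.g (b.x 1) = b.x 0 - b.x 1 := by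
  rw [b.g_x_succ 0 1 rfl, neg_one_smul, neg_add_eq_sub]

variable (b) in
lemma g_x0_neg : b.g (b.x 0) = -b.x 0 := by
  rw [g_x0, neg_one_smul]

include hb in
lemma super_sq : b.x 0 * b.x 0 = 0 := by
  refine hb _ (by simp [b.c_x]) fun i => ?_
  fin_cases i <;> simp [b.D_mul, b.D_x, g_x0_neg]

variable (b) in
lemma D_zero_anti : b.D 0 b.anti = b.x 0 := by
  simp [anti, b.D_mul, b.D_x, g_x1_neg]

variable (b) in
lemma D_one_anti : b.D 1 b.anti = 0 := by
  simp [anti, b.D_mul, b.D_x, g_x0_neg]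

include hb in
lemma g_anti : b.g b.anti = b.anti := by
  simp only [anti, map_add, map_mul, g_x0_neg, g_x1_neg, mul_sub, sub_mul, neg_mul, mul_neg,
    super_sq hb]
  abel

include hb in
lemma x0_mul_anti : b.x 0 * b.anti = b.anti * b.x 0 := by
  rw [anti, mul_add, add_mul, ← mul_assoc, ← mul_assoc, super_sq hb, mul_assoc (b.x 1),
    super_sq hb, zero_mul, mul_zero, add_zero, zero_add]

include hb in
lemma x1_mul_anti : b.x 1 * b.anti = b.anti * b.x 1 + b.x 0 * b.anti := by
  rw [← sub_eq_zero]
  refine hb _ (by simp [b.c_x]) fun i => ?_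
  fin_cases i
  · simp only [Fin.zero_eta, map_sub, map_add, b.D_mul, b.D_x, D_zero_anti, g_anti hb, g_x1_neg,
      mul_sub, super_sq hb]
    simp [anti]
  · simp [b.D_mul, b.D_x, D_one_anti, g_anti hb]

include hb in
lemma x1_mul_anti_pow (n : ℕ) :
    b.x 1 * b.anti ^ n = b.anti ^ n * b.x 1 + n • (b.x 0 * b.anti ^ n) := by
  have hc : ∀ n, b.x 0 * b.anti ^ n = b.anti ^ n * b.x 0 := fun n =>
    (Commute.pow_right (x0_mul_anti hb) n).eq
  induction n with
  | zero => simp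
  | succ n ih =>
    rw [pow_succ, ← mul_assoc, ih, add_mul, mul_assoc, x1_mul_anti hb, mul_add, ← mul_assoc,
      ← mul_assoc (b.anti ^ n), ← hc, smul_mul_assoc, succ_nsmul, mul_assoc (b.x 0)]
    abel

include hb in
lemma D_sq_mul_anti (u : b.A) : (b.D 0 ^ 2) (u * b.anti) = (b.D 0 ^ 2) u * b.anti + u := by
  simp only [pow_two, Module.End.mul_apply, b.D_mul, map_add, D_zero_anti, g_anti hb, g_x0_neg,
    b.D_x, if_true, mul_one, mul_neg]
  abel

include hb in
lemma D_pow_anti_pow (n : ℕ) : (b.D 0 ^ (2 * n)) (b.anti ^ n) = n.factorial • 1 := by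
  have h : ∀ n, (b.D 0 ^ 2) (b.anti ^ (n + 1)) = (n + 1) • b.anti ^ n := by
    intro n
    induction n with
    | zero => simp [pow_two, D_zero_anti, b.D_x]
    | succ n ih =>
      rw [pow_succ b.anti, D_sq_mul_anti hb, ih, smul_mul_assoc, ← pow_succ, ← succ_nsmul]
  induction n with
  | zero => simp
  | succ n ih =>
    rw [mul_add, mul_one, pow_add, Module.End.mul_apply, h, map_nsmul, ih, smul_smul,
      Nat.factorial_succ]

end SuperJordan

theorem GKdim_eq_top_of_neg_one [CharZero k] (b : Block k (-1) 3) : GKdim k b.A = ⊤ := by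
  refine b.GKdim_eq_top_of_tail 2 two_pos fun b' hb β h0 h1 m => ?_
  have hodd : ∀ m, β (2 * m) = m.factorial • b'.anti ^ m →
      β (2 * m + 1) = (m + 1).factorial • (b'.x 0 * b'.anti ^ m) := by
    intro m h
    rw [h1, h, show Fin.last 1 = 1 from rfl, mul_smul_comm, x1_mul_anti_pow hb, smul_mul_assoc,
      map_nsmul, map_mul, map_pow, g_anti hb, g_x1_neg, mul_sub,
      (Commute.pow_right (x0_mul_anti hb) m).eq, Nat.factorial_succ, mul_smul, smul_comm,
      neg_one_smul]
    module
  have heven : ∀ m, β (2 * m) = m.factorial • b'.anti ^ m := by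
    intro m
    induction m with
    | zero => simpa using h0
    | succ m ih =>
      have hx : b'.x 0 * b'.anti ^ m * b'.x 1 = b'.x 0 * b'.x 1 * b'.anti ^ m := by
        rw [mul_assoc, mul_assoc, x1_mul_anti_pow hb, mul_add, mul_smul_comm, ← mul_assoc (b'.x 0) (b'.x 0),
          super_sq hb]
        simp
      have hx' : b'.x 0 * b'.anti ^ m * b'.x 0 = 0 := by
        rw [(Commute.pow_right (x0_mul_anti hb) m).eq, mul_assoc, super_sq hb, mul_zero]
      rw [mul_add, mul_one, show 2 * m + 2 = 2 * m + 1 + 1 from rfl, h1, hodd m ih,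
        show Fin.last 1 = 1 from rfl, mul_smul_comm, smul_mul_assoc, map_nsmul, map_mul, map_mul,
        map_pow, g_anti hb, g_x1_neg, g_x0_neg, mul_sub, neg_mul, neg_mul, neg_mul, hx, hx', pow_succ',
        neg_one_smul]
      simp only [anti, add_mul, mul_assoc, smul_add]
      module
  rw [heven, map_nsmul, D_pow_anti_pow hb]
  simp [Nat.factorial_ne_zero]

end Block

section PowSum

variable {k A : Type*} [Field k] [Ring A] [Algebra k A]

/-- The sum of the subspaces `X * t ^ i` with `i < n`. -/
def powSum (X : Submodule k A) (t : A) : ℕ → Submodule k A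
  | 0 => ⊥
  | n + 1 => powSum X t n ⊔ X.map (LinearMap.mulRight k (t ^ n))

variable {X : Submodule k A} {t : A}

instance [FiniteDimensional k X] (n : ℕ) : FiniteDimensional k (powSum X t n) := by
  induction n with
  | zero => rw [powSum]; infer_instance
  | succ n ih => rw [powSum]; infer_instance

lemma powSum_le {Y : Submodule k A} {n : ℕ} (h : ∀ i < n, ∀ u ∈ X, u * t ^ i ∈ Y) :
    powSum X t n ≤ Y := by
  induction n with
  | zero => exact bot_le
  | succ n ih =>
    refine sup_le (ih fun i hi => h i (by omega)) ?_
    rintro _ ⟨u, hu, rfl⟩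
    exact h n n.lt_succ_self u hu

lemma mul_finrank_le_finrank_powSum [FiniteDimensional k X] {E : Module.End k A} {γ : ℕ → k}
    (hγ : ∀ n, γ n ≠ 0) (hE : ∀ u ∈ X, E u = 0)
    (h : ∀ n, ∀ u ∈ X, (E ^ n) (u * t ^ n) = γ n • u) (n : ℕ) :
    n * Module.finrank k X ≤ Module.finrank k (powSum X t n) := by
  induction n with
  | zero => simp
  | succ n ih =>
    have hker : powSum X t n ≤ LinearMap.ker (E ^ n) := powSum_le fun i hi u hu => by
      obtain ⟨j, rfl⟩ := Nat.exists_eq_add_of_lt hi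
      rw [LinearMap.mem_ker, show i + j + 1 = j + 1 + i by ring, pow_add, Module.End.mul_apply,
        h i u hu, map_smul, pow_succ, Module.End.mul_apply, hE u hu, map_zero, smul_zero]
    have hzero : ∀ u ∈ X, u * t ^ n ∈ powSum X t n → u = 0 := by
      intro u hu hut
      have h0 : (E ^ n) (u * t ^ n) = 0 := hker hut
      rw [h n u hu] at h0
      exact (smul_eq_zero.1 h0).resolve_left (hγ n)
    have hinf : powSum X t n ⊓ X.map (LinearMap.mulRight k (t ^ n)) = ⊥ := by
      rw [eq_bot_iff]
      rintro _ ⟨hy, u, hu, rfl⟩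
      simp [hzero u hu hy]
    have hinj : Module.finrank k (X.map (LinearMap.mulRight k (t ^ n))) = Module.finrank k X := by
      rw [← LinearMap.range_domRestrict]
      refine LinearMap.finrank_range_of_inj ((injective_iff_map_eq_zero _).2 ?_)
      rintro ⟨u, hu⟩ h
      have h : u * t ^ n = 0 := h
      exact Subtype.ext (hzero u hu (h ▸ Submodule.zero_mem _))
    have hsum := Submodule.finrank_sup_add_finrank_inf_eq (powSum X t n)
      (X.map (LinearMap.mulRight k (t ^ n)))
    rw [hinf, finrank_bot, add_zero, hinj] at hsum
    rw [powSum, hsum, add_mul, one_mul]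
    exact Nat.add_le_add_right ih _

end PowSum

namespace Block

variable {k : Type u} [Field k]

lemma powSum_le_fil {ε : k} {ℓ : ℕ} {b : Block k ε ℓ} {X : Submodule k b.A} {t : b.A} {p d : ℕ}
    (hX : X ≤ b.fil p) (ht : t ∈ b.fil d) (n : ℕ) : powSum X t n ≤ b.fil (p + d * n) := by
  have hpow : ∀ i, t ^ i ∈ b.fil (d * i) := by
    intro i
    rw [fil, pow_mul]
    exact Submodule.pow_mem_pow _ ht i
  refine powSum_le fun i hi u hu => b.fil_mono ?_ (mul_mem_fil (hX hu) (hpow i) rfl)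
  have := Nat.mul_le_mul_left d hi.le
  omega

/-- A two-step sum of powers certifies quadratic growth. -/
lemma two_le_GKdim_of_powSum {ε : k} {ℓ : ℕ} {b : Block k ε ℓ} {s t : b.A} {E F : Module.End k b.A}
    {γ δ : ℕ → k} {d : ℕ} (hd : 0 < d) (hs : s ∈ b.fil d) (ht : t ∈ b.fil d)
    (hγ : ∀ n, γ n ≠ 0) (hδ : ∀ n, δ n ≠ 0) (hE : E 1 = 0) (hEs : ∀ n, (E ^ n) (s ^ n) = γ n • 1)
    (hF : ∀ a, F (s ^ a) = 0) (hFt : ∀ n a, (F ^ n) (s ^ a * t ^ n) = δ n • s ^ a) :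
    2 ≤ GKdim k b.A := by
  refine two_le_GKdim (V := b.gens) (q := 2 * d) (by omega) fun r => ?_
  have h1 : Submodule.span k {(1 : b.A)} ≤ b.fil 0 :=
    (Submodule.span_singleton_le_iff_mem _ _).2 (b.one_mem_fil 0)
  set X := powSum (Submodule.span k {(1 : b.A)}) s r with hXdef
  have hX : r ≤ Module.finrank k X := by
    have := mul_finrank_le_finrank_powSum (X := Submodule.span k {(1 : b.A)}) (t := s) hγ
      (E := E) ?_ ?_ r
    · rwa [finrank_span_singleton, mul_one] at this
      intro h
      simpa using congrArg b.c h
    · intro u hu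
      obtain ⟨a, rfl⟩ := Submodule.mem_span_singleton.1 hu
      rw [map_smul, hE, smul_zero]
    · intro n u hu
      obtain ⟨a, rfl⟩ := Submodule.mem_span_singleton.1 hu
      rw [smul_one_mul, map_smul, hEs, smul_comm]
  have hspan : X ≤ Submodule.span k (Set.range fun a => s ^ a) := powSum_le fun i _ u hu => by
    obtain ⟨a, rfl⟩ := Submodule.mem_span_singleton.1 hu
    rw [smul_one_mul]
    exact Submodule.smul_mem _ _ (Submodule.subset_span ⟨i, rfl⟩)
  have hY := mul_finrank_le_finrank_powSum (X := X) (t := t) hδ (E := F)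
    (fun u hu => by
      have : Submodule.span k (Set.range fun a => s ^ a) ≤ LinearMap.ker F :=
        Submodule.span_le.2 (by rintro _ ⟨a, rfl⟩; exact hF a)
      exact this (hspan hu))
    (fun n u hu => by
      have : Submodule.span k (Set.range fun a => s ^ a) ≤
          LinearMap.eqLocus ((F ^ n) ∘ₗ LinearMap.mulRight k (t ^ n)) (δ n • LinearMap.id) :=
        Submodule.span_le.2 (by rintro _ ⟨a, rfl⟩; exact hFt n a)
      exact this (hspan hu)) r
  calc r ^ 2 = r * r := pow_two r
    _ ≤ r * Module.finrank k X := Nat.mul_le_mul_left r hX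
    _ ≤ _ := hY
    _ ≤ _ := b.finrank_le_of_le_fil ((powSum_le_fil (powSum_le_fil h1 hs r) ht r).trans
      (b.fil_mono (by nlinarith)))

section Jordan

variable {b : Block k 1 2}

lemma jordan_D_pow_mul {u z : b.A} (hz : b.D 1 z = 1) (n : ℕ) :
    (b.D 1 ^ (n + 1)) (u * z) =
      (b.D 1 ^ (n + 1)) u * (b.g ^ (n + 1)) z + (n + 1) • (b.D 1 ^ n) u := by
  have hg : ∀ z, b.D 1 (b.g z) = b.g (b.D 1 z) := fun z => by
    rw [b.D_g_last 1 rfl, one_smul]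
  induction n generalizing u z with
  | zero => simp [b.D_mul, hz]
  | succ n ih =>
    rw [pow_succ, Module.End.mul_apply, b.D_mul, hz, mul_one, map_add, ih (by rw [hg, hz, map_one]),
      succ_nsmul _ (n + 1), add_assoc]
    rfl

lemma jordan_D_pow_x1_pow (n : ℕ) : (b.D 1 ^ n) (b.x 1 ^ n) = n.factorial • 1 := by
  induction n with
  | zero => simp
  | succ n ih =>
    have hfil : b.x 1 ^ n ∈ b.fil n := by
      have := Submodule.pow_mem_pow _ (b.x_mem_fil 1) n
      rwa [fil, pow_one] at this
    rw [pow_succ (b.x 1), jordan_D_pow_mul (by simp [b.D_x]), D_pow_eq_zero 1 hfil n.lt_succ_self, ih,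
      zero_mul, zero_add, smul_smul, Nat.factorial_succ]

theorem two_le_GKdim_jordan [CharZero k] : 2 ≤ GKdim k b.A := by
  have hmul : ∀ n a v, (b.D 1 ^ n) (b.x 0 ^ a * v) = b.x 0 ^ a * (b.D 1 ^ n) v := fun n a v =>
    D_one_pow_mul_left (D_succ_x0_pow b a 0) n
  refine two_le_GKdim_of_powSum (s := b.x 0) (t := b.x 1) (E := b.D 0) (F := b.D 1)
    (δ := fun n => (n.factorial : k)) one_pos (b.x_mem_fil 0) (b.x_mem_fil 1) ?_ ?_ (b.D_one 0)
    (D_pow_x0_pow b) (fun a => D_succ_x0_pow b a 0) ?_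
  · refine fun n => Finset.prod_ne_zero_iff.2 fun j _ => ?_
    simpa using Nat.cast_add_one_ne_zero j
  · exact fun n => Nat.cast_ne_zero.2 n.factorial_ne_zero
  · intro n a
    rw [hmul, jordan_D_pow_x1_pow, mul_smul_comm, mul_one, Nat.cast_smul_eq_nsmul]

end Jordan

section SuperJordan

variable {b : Block k (-1) 2} (hb : b.Nondegenerate)

include hb in
lemma sq_mul_anti : b.x 1 ^ 2 * b.anti = b.anti * b.x 1 ^ 2 + b.anti ^ 2 := by
  have h := x1_mul_anti hb
  have h0 : b.x 0 * b.anti * b.x 1 = b.x 0 * b.x 1 * b.anti := by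
    rw [mul_assoc, mul_assoc, h, mul_add, ← mul_assoc (b.x 0) (b.x 0), super_sq hb]
    simp
  calc b.x 1 ^ 2 * b.anti = b.x 1 * (b.x 1 * b.anti) := by rw [pow_two, mul_assoc]
    _ = b.x 1 * b.anti * b.x 1 + b.x 1 * b.x 0 * b.anti := by
      conv_lhs => rw [h]
      noncomm_ring
    _ = b.anti * b.x 1 ^ 2 + (b.x 1 * b.x 0 + b.x 0 * b.x 1) * b.anti := by
      rw [h, add_mul, h0, pow_two]; noncomm_ring
    _ = _ := by rw [← anti, pow_two b.anti]

include hb in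
lemma x0_mul_sq : b.x 0 * b.x 1 ^ 2 = (b.x 1 ^ 2 - b.anti) * b.x 0 := by
  have h : b.x 0 * b.x 1 = b.anti - b.x 1 * b.x 0 := by rw [anti]; abel
  calc b.x 0 * b.x 1 ^ 2 = (b.x 0 * b.x 1) * b.x 1 := by rw [pow_two, mul_assoc]
    _ = b.anti * b.x 1 - b.x 1 * (b.x 0 * b.x 1) := by
      conv_lhs => rw [h]
      noncomm_ring
    _ = b.anti * b.x 1 - b.x 1 * b.anti + b.x 1 ^ 2 * b.x 0 := by rw [h, pow_two]; noncomm_ring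
    _ = _ := by rw [x1_mul_anti hb, x0_mul_anti hb]; noncomm_ring

include hb in
lemma g_sq : b.g (b.x 1 ^ 2) = b.x 1 ^ 2 - b.anti := by
  rw [map_pow, g_x1_neg, pow_two, sub_mul, mul_sub, super_sq hb, anti]
  noncomm_ring

variable (b) in
lemma D_zero_sq : b.D 0 (b.x 1 ^ 2) = 0 := by
  simp [pow_two, b.D_mul, b.D_x]

variable (b) in
lemma D_one_sq : b.D 1 (b.x 1 ^ 2) = b.x 0 := by
  simp [pow_two, b.D_mul, b.D_x, g_x1_neg]

variable (b) in
lemma D_one_anti_pow (a : ℕ) : b.D 1 (b.anti ^ a) = 0 := by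
  induction a with
  | zero => simp [D_one]
  | succ a ih => rw [pow_succ, b.D_mul, ih, D_one_anti, zero_mul, mul_zero, add_zero]

variable (b) in
/-- The span of the products of a power of `anti` with a power of `x 1 ^ 2` of exponent `< n`. -/
def lower (n : ℕ) : Submodule k b.A :=
  Submodule.span k {y | ∃ a c, c < n ∧ y = b.anti ^ a * (b.x 1 ^ 2) ^ c}

lemma mem_lower {n : ℕ} (a : ℕ) {c : ℕ} (h : c < n) :
    b.anti ^ a * (b.x 1 ^ 2) ^ c ∈ b.lower n :=
  Submodule.subset_span ⟨a, c, h, rfl⟩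

lemma lower_induction {n : ℕ} {φ : b.A →ₗ[k] b.A} {Y : Submodule k b.A}
    (h : ∀ a c, c < n → φ (b.anti ^ a * (b.x 1 ^ 2) ^ c) ∈ Y) {y : b.A} (hy : y ∈ b.lower n) :
    φ y ∈ Y := by
  have : b.lower n ≤ Y.comap φ := Submodule.span_le.2 (by
    rintro _ ⟨a, c, hc, rfl⟩
    exact h a c hc)
  exact this hy

lemma lower_mono {m n : ℕ} (hmn : m ≤ n) : b.lower m ≤ b.lower n := fun _ hy =>
  lower_induction (φ := LinearMap.id) (fun a _ hc => mem_lower a (hc.trans_le hmn)) hy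

lemma anti_pow_mul_lower {n : ℕ} (a : ℕ) {y : b.A} (hy : y ∈ b.lower n) :
    b.anti ^ a * y ∈ b.lower n :=
  lower_induction (φ := LinearMap.mulLeft k (b.anti ^ a)) (fun a' c hc => by
    rw [LinearMap.mulLeft_apply, ← mul_assoc, ← pow_add]
    exact mem_lower _ hc) hy

lemma lower_mul_sq {n : ℕ} {y : b.A} (hy : y ∈ b.lower n) : y * b.x 1 ^ 2 ∈ b.lower (n + 1) :=
  lower_induction (φ := LinearMap.mulRight k (b.x 1 ^ 2)) (fun a c hc => by
    rw [LinearMap.mulRight_apply, mul_assoc, ← pow_succ]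
    exact mem_lower _ (Nat.succ_lt_succ hc)) hy

include hb in
lemma lower_mul_anti {n : ℕ} {y : b.A} (hy : y ∈ b.lower n) : y * b.anti ∈ b.lower n := by
  induction n generalizing y with
  | zero => exact lower_induction (φ := LinearMap.mulRight k b.anti) (fun a c hc => by omega) hy
  | succ n ih =>
    refine lower_induction (φ := LinearMap.mulRight k b.anti) (fun a c hc => ?_) hy
    rw [LinearMap.mulRight_apply]
    cases c with
    | zero => simpa [pow_succ] using mem_lower (b := b) (a + 1) n.succ_pos
    | succ c =>
      have hc' : c < n := by omega
      rw [pow_succ, mul_assoc, mul_assoc, sq_mul_anti hb, mul_add, mul_add, ← mul_assoc _ b.anti,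
        pow_two b.anti, ← mul_assoc _ b.anti b.anti, ← mul_assoc, ← mul_assoc,
        ← mul_assoc (b.anti ^ a), ← mul_assoc (b.anti ^ a)]
      have h := ih (mem_lower (b := b) a hc')
      exact Submodule.add_mem _ (lower_mul_sq h) (lower_mono n.le_succ (ih h))

include hb in
lemma D_one_sq_pow (c : ℕ) : ∃ y ∈ b.lower c,
    b.D 1 ((b.x 1 ^ 2) ^ (c + 1)) = ((c + 1) • (b.x 1 ^ 2) ^ c + y) * b.x 0 := by
  induction c with
  | zero => exact ⟨0, Submodule.zero_mem _, by simp [D_one_sq]⟩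
  | succ c ih =>
    obtain ⟨y, hy, h⟩ := ih
    have hx : b.x 0 * (b.x 1 ^ 2 - b.anti) = (b.x 1 ^ 2 - 2 • b.anti) * b.x 0 := by
      rw [mul_sub, x0_mul_sq hb, x0_mul_anti hb]; noncomm_ring
    refine ⟨y * b.x 1 ^ 2 - 2 • (((c + 1) • (b.x 1 ^ 2) ^ c + y) * b.anti), ?_, ?_⟩
    · have hc : (c + 1) • (b.x 1 ^ 2) ^ c ∈ b.lower (c + 1) :=
        nsmul_mem (by simpa using mem_lower (b := b) 0 c.lt_succ_self) _
      exact Submodule.sub_mem _ (lower_mul_sq hy) (nsmul_mem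
        (lower_mul_anti hb (Submodule.add_mem _ hc (lower_mono c.le_succ hy))) _)
    · rw [pow_succ (b.x 1 ^ 2), b.D_mul, h, g_sq hb, D_one_sq, mul_assoc, hx]
      simp only [pow_succ (b.x 1 ^ 2), add_mul, sub_mul, mul_sub, add_smul, one_smul, smul_add,
        smul_mul_assoc, mul_smul_comm, mul_assoc]
      abel

include hb in
lemma D_zero_mul_x0 {n : ℕ} {y : b.A} (hy : y ∈ b.lower n) : b.D 0 y * b.x 0 = 0 := by
  have := lower_induction (Y := ⊥) (φ := LinearMap.mulRight k (b.x 0) ∘ₗ b.D 0)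
    (fun a c hc => ?_) hy
  · simpa using this
  · clear hc
    simp only [LinearMap.comp_apply, LinearMap.mulRight_apply, Submodule.mem_bot]
    induction c with
    | zero =>
      rw [pow_zero, mul_one]
      induction a with
      | zero => simp [D_one]
      | succ a ih =>
        rw [pow_succ, b.D_mul, g_anti hb, D_zero_anti, add_mul, mul_assoc, mul_assoc, super_sq hb,
          ← x0_mul_anti hb, ← mul_assoc, ih, zero_mul, mul_zero, add_zero]
    | succ c ih =>
      rw [pow_succ, ← mul_assoc, b.D_mul, D_zero_sq, mul_zero, add_zero, g_sq hb, mul_assoc,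
        ← x0_mul_sq hb, ← mul_assoc, ih, zero_mul]

include hb in
lemma D_zero_D_one_mul (a c : ℕ) : ∃ y ∈ b.lower c,
    (b.D 0 * b.D 1) (b.anti ^ a * (b.x 1 ^ 2) ^ (c + 1)) =
      (c + 1) • (b.anti ^ a * (b.x 1 ^ 2) ^ c) + y := by
  obtain ⟨y, hy, h⟩ := D_one_sq_pow hb c
  refine ⟨b.anti ^ a * y, anti_pow_mul_lower a hy, ?_⟩
  have hv : b.anti ^ a * ((c + 1) • (b.x 1 ^ 2) ^ c + y) ∈ b.lower (c + 1) :=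
    anti_pow_mul_lower a (Submodule.add_mem _
      (nsmul_mem (by simpa using mem_lower (b := b) 0 c.lt_succ_self) _)
      (lower_mono c.le_succ hy))
  rw [Module.End.mul_apply, b.D_mul, D_one_anti_pow, zero_mul, zero_add, h, ← mul_assoc, b.D_mul,
    g_x0_neg, mul_neg, D_zero_mul_x0 hb hv, b.D_x, if_pos rfl, mul_one, neg_zero, zero_add, mul_add,
    mul_smul_comm]

include hb in
lemma D_zero_D_one_pow_lower {n : ℕ} {y : b.A} (hy : y ∈ b.lower n) :
    ((b.D 0 * b.D 1) ^ n) y = 0 := by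
  induction n generalizing y with
  | zero =>
    exact lower_induction (Y := ⊥) (φ := LinearMap.id) (fun a c hc => by omega) hy
  | succ n ih =>
    rw [pow_succ, Module.End.mul_apply]
    refine ih (lower_induction (φ := b.D 0 * b.D 1) (fun a c hc => ?_) hy)
    cases c with
    | zero => simp [D_one_anti_pow]
    | succ c =>
      obtain ⟨y, hy, h⟩ := D_zero_D_one_mul hb a c
      rw [h]
      exact Submodule.add_mem _ (nsmul_mem (mem_lower a (by omega)) _) (lower_mono (by omega) hy)

include hb in
theorem two_le_GKdim_superJordan [CharZero k] : 2 ≤ GKdim k b.A := by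
  have hx : ∀ i j, b.x i * b.x j ∈ b.fil 2 := fun i j =>
    mul_mem_fil (b.x_mem_fil i) (b.x_mem_fil j) rfl
  have hfac : ∀ n : ℕ, (n.factorial : k) ≠ 0 := fun n => Nat.cast_ne_zero.2 n.factorial_ne_zero
  refine two_le_GKdim_of_powSum (s := b.anti) (t := b.x 1 ^ 2) (E := b.D 0 ^ 2)
    (F := b.D 0 * b.D 1) (γ := fun n => (n.factorial : k)) (δ := fun n => (n.factorial : k))
    two_pos (Submodule.add_mem _ (hx 1 0) (hx 0 1)) (by rw [pow_two]; exact hx 1 1) hfac hfac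
    (by simp [pow_two, D_one]) (fun n => ?_) (fun a => by simp [D_one_anti_pow]) (fun n a => ?_)
  · rw [← pow_mul, D_pow_anti_pow hb, Nat.cast_smul_eq_nsmul]
  · rw [Nat.cast_smul_eq_nsmul]
    induction n with
    | zero => simp
    | succ n ih =>
      obtain ⟨y, hy, h⟩ := D_zero_D_one_mul hb a n
      rw [pow_succ (b.D 0 * b.D 1), Module.End.mul_apply, h, map_add, map_nsmul, ih,
        D_zero_D_one_pow_lower hb hy, add_zero, smul_smul, Nat.factorial_succ]

end SuperJordan

end Block

section UpperBound

variable {k : Type u} [Field k] {A : Type u} [Ring A] [Algebra k A]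

theorem GKdim_le_two_of_card_le (x : Fin 2 → A) (hx : Algebra.adjoin k (Set.range x) = ⊤) (C : ℕ)
    (S : ℕ → Finset A) (hS : ∀ n, (S n).card ≤ C * (n + 1) ^ 2) (hmono : Monotone S)
    (h1 : 1 ∈ S 0)
    (hmul : ∀ i n, ∀ s ∈ S n, x i * s ∈ Submodule.span k (S (n + 1) : Set A)) :
    GKdim k A ≤ 2 := by
  classical
  set G : Submodule k A := Submodule.span k (insert 1 (Set.range x)) with hG
  have hGS : ∀ n, G ^ n ≤ Submodule.span k (S n : Set A) := by
    intro n
    induction n with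
    | zero =>
      rw [pow_zero, Submodule.one_eq_span, Submodule.span_le, Set.singleton_subset_iff]
      exact Submodule.subset_span h1
    | succ n ih =>
      rw [pow_succ']
      refine (mul_le_mul' le_rfl ih).trans ?_
      rw [hG, Submodule.span_mul_span, Submodule.span_le, Set.mul_subset_iff]
      rintro _ (rfl | ⟨i, rfl⟩) s hs
      · rw [one_mul]
        exact Submodule.subset_span (hmono n.le_succ hs)
      · exact hmul i n s hs
  have hG1 : 1 ≤ G := by
    rw [Submodule.one_le]
    exact Submodule.subset_span (Set.mem_insert _ _)
  have hGm : Monotone fun n => G ^ n := fun m n h => pow_le_pow_right' hG1 h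
  have hGtop : ∀ y : A, ∃ n, y ∈ G ^ n := by
    intro y
    have hy : y ∈ Algebra.adjoin k (Set.range x) := by rw [hx]; trivial
    induction hy using Algebra.adjoin_induction with
    | mem y hy => exact ⟨1, by rw [pow_one]; exact Submodule.subset_span (Set.mem_insert_of_mem _ hy)⟩
    | algebraMap r => exact ⟨0, by rw [pow_zero]; exact Submodule.algebraMap_mem r⟩
    | add u v _ _ hu hv =>
      obtain ⟨m, hm⟩ := hu
      obtain ⟨n, hn⟩ := hv
      exact ⟨max m n, Submodule.add_mem _ (hGm (le_max_left m n) hm) (hGm (le_max_right m n) hn)⟩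
    | mul u v _ _ hu hv =>
      obtain ⟨m, hm⟩ := hu
      obtain ⟨n, hn⟩ := hv
      exact ⟨m + n, by rw [pow_add]; exact Submodule.mul_mem_mul hm hn⟩
  refine GKdim_le_two fun V hV => ?_
  obtain ⟨s, rfl⟩ := (Submodule.fg_iff_finiteDimensional V).2 hV
  choose d hd using hGtop
  have hVm : Submodule.span k (s : Set A) ≤ G ^ s.sup d := Submodule.span_le.2 fun y hy =>
    hGm (Finset.le_sup (f := d) hy) (hd y)
  set m := s.sup d
  refine ⟨C * (m + 1) ^ 2, fun n => ?_⟩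
  have hle : ∑ j ∈ Finset.range (n + 1), Submodule.span k (s : Set A) ^ j ≤
      Submodule.span k (S (m * n) : Set A) := by
    refine Finset.sum_induction _ (· ≤ Submodule.span k (S (m * n) : Set A))
      (fun _ _ => sup_le) bot_le fun j hj => ?_
    refine (pow_le_pow_left' hVm j).trans ?_
    rw [← pow_mul]
    exact (hGm (Nat.mul_le_mul_left m (Nat.lt_succ_iff.1 (Finset.mem_range.1 hj)))).trans (hGS _)
  calc _ ≤ Module.finrank k (Submodule.span k (S (m * n) : Set A)) := Submodule.finrank_mono hle
    _ ≤ (S (m * n)).card := finrank_span_finset_le_card _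
    _ ≤ C * (m * n + 1) ^ 2 := hS _
    _ ≤ C * ((m + 1) * (n + 1)) ^ 2 := by gcongr; nlinarith
    _ = _ := by ring

theorem GKdim_le_two_of_jordan (x : Fin 2 → A) (hx : Algebra.adjoin k (Set.range x) = ⊤) (r : k)
    (h : x 1 * x 0 = x 0 * x 1 + r • x 0 ^ 2) : GKdim k A ≤ 2 := by
  classical
  have hpow : ∀ a : ℕ, x 1 * x 0 ^ a = x 0 ^ a * x 1 + (a * r) • x 0 ^ (a + 1) := by
    intro a
    induction a with
    | zero => simp
    | succ a ih =>
      rw [pow_succ, ← mul_assoc, ih, add_mul, mul_assoc, h, mul_add, smul_mul_assoc,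
        mul_smul_comm, ← pow_add, ← pow_succ, ← mul_assoc, add_assoc, ← add_smul]
      push_cast
      ring_nf
  refine GKdim_le_two_of_card_le x hx 1
    (fun n => (Finset.range (n + 1) ×ˢ Finset.range (n + 1)).image
      fun p => x 0 ^ p.1 * x 1 ^ p.2) (fun n => ?_) (fun m n hmn => ?_) ?_ fun i n s hs => ?_
  · refine Finset.card_image_le.trans ?_
    simp [pow_two]
  · exact Finset.image_subset_image (Finset.product_subset_product
      (Finset.range_mono (by omega)) (Finset.range_mono (by omega)))
  · exact Finset.mem_image.2 ⟨(0, 0), by simp, by simp⟩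
  · have hmem : ∀ a b : ℕ, a ≤ n + 1 → b ≤ n + 1 → x 0 ^ a * x 1 ^ b ∈ Submodule.span k
        (((Finset.range (n + 1 + 1) ×ˢ Finset.range (n + 1 + 1)).image
          fun p => x 0 ^ p.1 * x 1 ^ p.2 : Finset A) : Set A) := fun a b ha hb =>
      Submodule.subset_span (Finset.mem_coe.2 (Finset.mem_image.2
        ⟨(a, b), by simp; omega, rfl⟩))
    obtain ⟨⟨a, b⟩, hab, rfl⟩ := Finset.mem_image.1 hs
    simp only [Finset.mem_product, Finset.mem_range] at hab
    fin_cases i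
    · change x 0 * (x 0 ^ a * x 1 ^ b) ∈ _
      rw [← mul_assoc, ← pow_succ']
      exact hmem _ _ (by omega) (by omega)
    · change x 1 * (x 0 ^ a * x 1 ^ b) ∈ _
      rw [← mul_assoc, hpow, add_mul, mul_assoc, ← pow_succ', smul_mul_assoc]
      exact Submodule.add_mem _ (hmem _ _ (by omega) (by omega))
        (Submodule.smul_mem _ _ (hmem _ _ (by omega) (by omega)))

theorem GKdim_le_two_of_superJordan (x : Fin 2 → A) (hx : Algebra.adjoin k (Set.range x) = ⊤)
    (h0 : x 0 * x 0 = 0) (w : A) (hw : w = x 1 * x 0 + x 0 * x 1)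
    (h : x 1 * w = w * x 1 + x 0 * w) : GKdim k A ≤ 2 := by
  classical
  have hcomm : Commute (x 0) w := by
    rw [Commute, SemiconjBy]
    rw [hw, mul_add, add_mul, ← mul_assoc (x 0) (x 0), h0, mul_assoc (x 1), h0]
    simp [mul_assoc]
  have hpow : ∀ a : ℕ, x 1 * w ^ a = w ^ a * x 1 + (a : k) • (x 0 * w ^ a) := by
    intro a
    induction a with
    | zero => simp
    | succ a ih =>
      have : w ^ a * (x 0 * w) = x 0 * (w ^ a * w) := by
        rw [← mul_assoc, ← mul_assoc, (hcomm.pow_right a).eq]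
      rw [pow_succ, ← mul_assoc, ih, add_mul, mul_assoc, h, mul_add, this, smul_mul_assoc,
        mul_assoc (x 0), mul_assoc (w ^ a)]
      push_cast
      rw [add_smul, one_smul]
      abel
  refine GKdim_le_two_of_card_le x hx 2
    (fun n => (Finset.range 2 ×ˢ Finset.range (n + 1) ×ˢ Finset.range (n + 1)).image
      fun p => x 0 ^ p.1 * (w ^ p.2.1 * x 1 ^ p.2.2)) (fun n => ?_) (fun m n hmn => ?_) ?_
      fun i n s hs => ?_
  · refine Finset.card_image_le.trans ?_
    simp [pow_two]
  · exact Finset.image_subset_image (Finset.product_subset_product subset_rfl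
      (Finset.product_subset_product (Finset.range_mono (by omega)) (Finset.range_mono (by omega))))
  · exact Finset.mem_image.2 ⟨(0, 0, 0), by simp, by simp⟩
  · have hmem : ∀ a b c : ℕ, a < 2 → b ≤ n + 1 → c ≤ n + 1 →
        x 0 ^ a * (w ^ b * x 1 ^ c) ∈ Submodule.span k
        (((Finset.range 2 ×ˢ Finset.range (n + 1 + 1) ×ˢ Finset.range (n + 1 + 1)).image
          fun p => x 0 ^ p.1 * (w ^ p.2.1 * x 1 ^ p.2.2) : Finset A) : Set A) := fun a b c _ _ _ =>
      Submodule.subset_span (Finset.mem_coe.2 (Finset.mem_image.2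
        ⟨(a, b, c), by simp; omega, rfl⟩))
    have hmem0 := fun b c => hmem 0 b c two_pos
    have hmem1 := fun b c => hmem 1 b c one_lt_two
    simp only [pow_zero, one_mul, pow_one] at hmem0 hmem1
    have hpow' : ∀ b c : ℕ, x 1 * (w ^ b * x 1 ^ c) =
        w ^ b * x 1 ^ (c + 1) + (b : k) • (x 0 * (w ^ b * x 1 ^ c)) := fun b c => by
      rw [← mul_assoc, hpow, add_mul, mul_assoc, ← pow_succ', smul_mul_assoc, mul_assoc]
    obtain ⟨⟨a, b, c⟩, habc, rfl⟩ := Finset.mem_image.1 hs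
    simp only [Finset.mem_product, Finset.mem_range] at habc
    obtain rfl | rfl : a = 0 ∨ a = 1 := by omega
    · simp only [pow_zero, one_mul]
      fin_cases i
      · exact hmem1 _ _ (by omega) (by omega)
      · change x 1 * _ ∈ _
        rw [hpow']
        exact Submodule.add_mem _ (hmem0 _ _ (by omega) (by omega))
          (Submodule.smul_mem _ _ (hmem1 _ _ (by omega) (by omega)))
    · simp only [pow_one]
      fin_cases i
      · change x 0 * _ ∈ _
        rw [← mul_assoc, h0, zero_mul]
        exact Submodule.zero_mem _
      · change x 1 * _ ∈ _
        have : x 1 * (x 0 * (w ^ b * x 1 ^ c)) =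
            w ^ (b + 1) * x 1 ^ c - x 0 * (w ^ b * x 1 ^ (c + 1)) := by
          rw [← mul_assoc, show x 1 * x 0 = w - x 0 * x 1 by rw [hw]; abel, sub_mul, mul_assoc (x 0),
            hpow', mul_add, mul_smul_comm, ← mul_assoc (x 0) (x 0), h0, zero_mul, smul_zero,
            add_zero, ← mul_assoc w, ← pow_succ']
        rw [this]
        exact Submodule.sub_mem _ (hmem0 _ _ (by omega) (by omega))
          (hmem1 _ _ (by omega) (by omega))

end UpperBound

section NicholsRelations

variable {k : Type u} [Field k] {ℓ : ℕ}
  {D : Fin ℓ → (FreeAlgebra k (Fin ℓ) →ₗ[k] FreeAlgebra k (Fin ℓ))}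

lemma mem_nicholsSet {n : ℕ} (hn : 2 ≤ n) {u : FreeAlgebra k (Fin ℓ)} (hu : u ∈ degComp k ℓ n)
    (h : ∀ i j, D i (D j u) = 0) : u ∈ nicholsSet D := by
  refine ⟨n, hn, hu, fun l hl => ?_⟩
  obtain ⟨i, j, l', rfl⟩ : ∃ i j l', l = l' ++ [i, j] := by
    induction l using List.reverseRecOn with
    | nil => simp at hl; omega
    | append_singleton l j _ =>
      induction l using List.reverseRecOn with
      | nil => simp at hl; omega
      | append_singleton l i _ => exact ⟨i, j, l, by simp⟩
  rw [List.foldr_append]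
  simp only [List.foldr_cons, List.foldr_nil, h]
  clear hl
  induction l' with
  | nil => rfl
  | cons i l ih => rw [List.foldr_cons, ih, map_zero]

lemma mkAlgHom_nicholsRel {u : FreeAlgebra k (Fin ℓ)} (hu : u ∈ nicholsSet D) :
    RingQuot.mkAlgHom k (nicholsRel D) u = 0 := by
  rw [RingQuot.mkAlgHom_rel k (show nicholsRel D u 0 from ⟨hu, rfl⟩), map_zero]

lemma adjoin_mkAlgHom_ι :
    Algebra.adjoin k (Set.range fun i => RingQuot.mkAlgHom k (nicholsRel D) (FreeAlgebra.ι k i)) =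
      ⊤ := by
  rw [Set.range_comp' (RingQuot.mkAlgHom k (nicholsRel D)) (FreeAlgebra.ι k), ← AlgHom.map_adjoin,
    FreeAlgebra.adjoin_range_ι, Algebra.map_top, AlgHom.range_eq_top]
  exact RingQuot.mkAlgHom_surjective _ _

lemma ι_mem_degComp (i : Fin ℓ) : FreeAlgebra.ι k i ∈ degComp k ℓ 1 := by
  rw [degComp, pow_one]
  exact Submodule.subset_span ⟨i, rfl⟩

lemma mul_mem_degComp {m n p : ℕ} (h : m + n = p) {u v : FreeAlgebra k (Fin ℓ)}
    (hu : u ∈ degComp k ℓ m) (hv : v ∈ degComp k ℓ n) : u * v ∈ degComp k ℓ p := by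
  subst h
  rw [degComp, pow_add]
  exact Submodule.mul_mem_mul hu hv

end NicholsRelations

section RankTwo

variable {k : Type u} [Field k] {ε : k}
  {D : Fin 2 → (FreeAlgebra k (Fin 2) →ₗ[k] FreeAlgebra k (Fin 2))}
  (hDx : ∀ i j, D i (FreeAlgebra.ι k j) = if i = j then 1 else 0)
  (hDmul : ∀ i (u v : FreeAlgebra k (Fin 2)), D i (u * v) = D i u * blockAut k 2 ε v + u * D i v)

lemma blockAut_ι_zero : blockAut k 2 ε (FreeAlgebra.ι k 0) = ε • FreeAlgebra.ι k 0 := by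
  simp [blockAut]

lemma blockAut_ι_one :
    blockAut k 2 ε (FreeAlgebra.ι k 1) = ε • FreeAlgebra.ι k 1 + FreeAlgebra.ι k 0 := by
  simp [blockAut]

include hDx hDmul

theorem GKdim_nichols_one_le_two [CharZero k] (hε : ε = 1) :
    GKdim k (RingQuot (nicholsRel D)) ≤ 2 := by
  subst hε
  set X := FreeAlgebra.ι k (X := Fin 2)
  have hX2 : ∀ i j, X i * X j ∈ degComp k 2 2 := fun i j =>
    mul_mem_degComp rfl (ι_mem_degComp i) (ι_mem_degComp j)
  have hmem : X 1 * X 0 - X 0 * X 1 + (2⁻¹ : k) • (X 0 * X 0) ∈ nicholsSet D := by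
    refine mem_nicholsSet le_rfl (Submodule.add_mem _ (Submodule.sub_mem _ (hX2 _ _) (hX2 _ _))
      (Submodule.smul_mem _ _ (hX2 _ _))) fun i j => ?_
    have : D j (X 1 * X 0 - X 0 * X 1 + (2⁻¹ : k) • (X 0 * X 0)) = 0 := by
      fin_cases j
      · simp [hDmul, X, hDx, blockAut_ι_zero, blockAut_ι_one]
        module
      · simp [hDmul, X, hDx, blockAut_ι_zero, blockAut_ι_one]
    rw [this, map_zero]
  have h := mkAlgHom_nicholsRel hmem
  refine GKdim_le_two_of_jordan _ adjoin_mkAlgHom_ι (-2⁻¹) ?_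
  rw [map_add, map_sub, map_smul, map_mul, map_mul, map_mul] at h
  rw [pow_two, ← sub_eq_zero, ← h]
  module

theorem GKdim_nichols_neg_one_le_two (hε : ε = -1) :
    GKdim k (RingQuot (nicholsRel D)) ≤ 2 := by
  subst hε
  set X := FreeAlgebra.ι k (X := Fin 2)
  have hX2 : ∀ i j, X i * X j ∈ degComp k 2 2 := fun i j =>
    mul_mem_degComp rfl (ι_mem_degComp i) (ι_mem_degComp j)
  have hD0 : ∀ j, D j (X 0 * X 0) = 0 := by
    intro j
    simp [hDmul, X, hDx, blockAut_ι_zero]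
  have h0 := mkAlgHom_nicholsRel (mem_nicholsSet le_rfl (hX2 0 0) fun i j => by
    rw [hD0, map_zero] : X 0 * X 0 ∈ nicholsSet D)
  set W := X 1 * X 0 + X 0 * X 1 with hW
  have hW2 : W ∈ degComp k 2 2 := Submodule.add_mem _ (hX2 _ _) (hX2 _ _)
  have hmem : X 1 * W - W * X 1 - X 0 * W ∈ nicholsSet D := by
    refine mem_nicholsSet (n := 3) (by norm_num) (Submodule.sub_mem _ (Submodule.sub_mem _
      (mul_mem_degComp rfl (ι_mem_degComp _) hW2) (mul_mem_degComp rfl hW2 (ι_mem_degComp _)))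
      (mul_mem_degComp rfl (ι_mem_degComp _) hW2)) fun i j => ?_
    have : D j (X 1 * W - W * X 1 - X 0 * W) ∈ Submodule.span k {X 0 * X 0} := by
      rw [Submodule.mem_span_singleton]
      fin_cases j
      · refine ⟨0, ?_⟩
        simp [hW, hDmul, X, hDx, blockAut_ι_zero, blockAut_ι_one]
        noncomm_ring
      · refine ⟨-2, ?_⟩
        simp [hW, hDmul, X, hDx, blockAut_ι_zero, blockAut_ι_one, neg_smul, two_smul]
        noncomm_ring
    obtain ⟨r, hr⟩ := Submodule.mem_span_singleton.1 this
    rw [← hr, map_smul, hD0, smul_zero]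
  have h := mkAlgHom_nicholsRel hmem
  refine GKdim_le_two_of_superJordan _ adjoin_mkAlgHom_ι ?_
    (RingQuot.mkAlgHom k (nicholsRel D) W) ?_ ?_
  · rw [← map_mul, h0]
  · simp only [hW, map_add, map_mul, X]
  · simp only [map_sub, map_mul] at h
    rw [← sub_eq_zero, ← h]
    abel

end RankTwo

namespace Block

variable {k : Type u} [Field k] {ε : k} {b : Block k ε 2}

lemma Nondegenerate.ext (hb : b.Nondegenerate) {y z : b.A} (hc : b.c y = b.c z)
    (h0 : b.D 0 y = b.D 0 z) (h1 : b.D 1 y = b.D 1 z) : y = z := by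
  refine sub_eq_zero.1 (hb _ (by rw [map_sub, hc, sub_self]) fun i => ?_)
  rw [map_sub, sub_eq_zero]
  fin_cases i
  · exact h0
  · exact h1

lemma D_zero_x0 : b.D 0 (b.x 0) = 1 := by rw [b.D_x, if_pos rfl]

lemma D_one_x0 : b.D 1 (b.x 0) = 0 := by rw [b.D_x, if_neg one_ne_zero]

lemma D_zero_x1 : b.D 0 (b.x 1) = 0 := by rw [b.D_x, if_neg zero_ne_one]

lemma D_one_x1 : b.D 1 (b.x 1) = 1 := by rw [b.D_x, if_pos rfl]

lemma g_x1 : b.g (b.x 1) = ε • b.x 1 + b.x 0 := b.g_x_succ 0 1 rfl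

lemma D_zero_g (y : b.A) : b.D 0 (b.g y) = b.g (ε • b.D 0 y + b.D 1 y) := b.D_g_succ 0 1 rfl y

lemma D_one_g (y : b.A) : b.D 1 (b.g y) = ε • b.g (b.D 1 y) := b.D_g_last 1 rfl y

lemma D_one_x0_pow (n : ℕ) : b.D 1 (b.x 0 ^ n) = 0 := D_succ_x0_pow (ℓ := 1) b n 0

/-- The quantum integer. -/
def qnum (ε : k) (n : ℕ) : k := ∑ i ∈ Finset.range n, ε ^ i

lemma qnum_succ (n : ℕ) : qnum ε (n + 1) = ε * qnum ε n + 1 := by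
  rw [qnum, qnum, Finset.sum_range_succ', Finset.mul_sum, pow_zero]
  simp only [pow_succ']

lemma one_sub_mul_qnum (n : ℕ) : (1 - ε) * qnum ε n = 1 - ε ^ n := by
  rw [mul_comm, qnum, geom_sum_mul_neg]

lemma D_zero_x0_pow (n : ℕ) : b.D 0 (b.x 0 ^ (n + 1)) = qnum ε (n + 1) • b.x 0 ^ n :=
  D_x0_pow_succ b n

section Sums

variable (b)

/-- The sum of the words of length `n` with one letter `x 1` and the other letters `x 0`. -/
def word1 : ℕ → b.A
  | 0 => 0
  | n + 1 => word1 n * b.x 0 + b.x 0 ^ n * b.x 1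

/-- The sum of the words of length `n` with two letters `x 1` and the other letters `x 0`. -/
def word2 : ℕ → b.A
  | 0 => 0
  | n + 1 => word2 n * b.x 0 + b.word1 n * b.x 1

/-- The coefficient of the power of `x 0` in the derivative of `word1`. -/
def wordCoeff (ε : k) : ℕ → k
  | 0 => 0
  | n + 1 => ε * wordCoeff ε n + qnum ε (n + 1)

variable {b}

lemma D_one_word1 (n : ℕ) : b.D 1 (b.word1 (n + 1)) = qnum ε (n + 1) • b.x 0 ^ n := by
  induction n with
  | zero => simp [word1, D_one_x1, qnum]
  | succ n ih =>
    rw [word1, map_add, b.D_mul, b.D_mul, ih, D_one_x0, D_one_x1, D_one_x0_pow, g_x0,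
      qnum_succ (n + 1), pow_succ]
    simp only [smul_mul_assoc, mul_smul_comm, mul_zero, zero_mul, mul_one, add_zero, zero_add]
    module

lemma D_zero_word1 (n : ℕ) : b.D 0 (b.word1 (n + 1)) =
    qnum ε (n + 1) • b.word1 n + wordCoeff ε n • b.x 0 ^ n := by
  induction n with
  | zero => simp [word1, D_zero_x1, wordCoeff]
  | succ n ih =>
    rw [word1, map_add, b.D_mul, b.D_mul, ih, D_zero_x0, D_zero_x1, D_zero_x0_pow, g_x0, g_x1,
      qnum_succ (n + 1), wordCoeff, word1, pow_succ]
    simp only [smul_mul_assoc, mul_smul_comm, mul_zero, mul_one, add_zero, add_mul, mul_add]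
    module

lemma D_one_word2 (n : ℕ) : b.D 1 (b.word2 (n + 1)) =
    qnum ε (n + 1) • b.word1 n + wordCoeff ε n • b.x 0 ^ n := by
  induction n with
  | zero => simp [word1, word2, wordCoeff]
  | succ n ih =>
    rw [word2, map_add, b.D_mul, b.D_mul, ih, D_one_x0, D_one_x1, D_one_word1, g_x0, g_x1,
      qnum_succ (n + 1), wordCoeff, word1, pow_succ]
    simp only [smul_mul_assoc, mul_smul_comm, mul_zero, mul_one, add_zero, add_mul, mul_add]
    module

lemma g_word1 (n : ℕ) : b.g (b.word1 (n + 1)) =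
    ε ^ (n + 1) • b.word1 (n + 1) + ((n + 1 : ℕ) * ε ^ n) • b.x 0 ^ (n + 1) := by
  induction n with
  | zero => simp [word1, g_x1]
  | succ n ih =>
    rw [word1, map_add, map_mul, map_mul, ih, g_x0, g_x1, map_pow, g_x0, smul_pow]
    simp only [smul_mul_assoc, mul_smul_comm, add_mul, mul_add, smul_add, ← pow_succ]
    push_cast
    module

lemma g_word2 (n : ℕ) : ∃ δ : k, b.g (b.word2 (n + 1)) =
    ε ^ (n + 1) • b.word2 (n + 1) + (n * ε ^ n) • b.word1 (n + 1) + δ • b.x 0 ^ (n + 1) := by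
  induction n with
  | zero => exact ⟨0, by simp [word1, word2]⟩
  | succ n ih =>
    obtain ⟨δ, h⟩ := ih
    refine ⟨ε * δ + ((n + 1 : ℕ) * ε ^ n), ?_⟩
    have hw : b.word1 (n + 1 + 1) = b.word1 (n + 1) * b.x 0 + b.x 0 ^ (n + 1) * b.x 1 := rfl
    rw [word2, map_add, map_mul, map_mul, h, g_word1, g_x0, g_x1, hw]
    simp only [smul_mul_assoc, mul_smul_comm, add_mul, mul_add, smul_add, ← pow_succ]
    push_cast
    module

variable (b) in
/-- The elements of degree `n` having the shape of the words with at most one letter `x 1`, as far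
as the derivations and `g` can see. -/
def row : ℕ → Submodule k b.A
  | 0 => Submodule.span k {1}
  | n + 1 => (row n).comap (b.D 0) ⊓ (Submodule.span k {b.x 0 ^ n}).comap (b.D 1) ⊓
      (Submodule.span k {b.x 0 ^ (n + 1)}).comap (b.g.toLinearMap - ε ^ (n + 1) • LinearMap.id)

lemma mem_row_succ {n : ℕ} {y : b.A} : y ∈ b.row (n + 1) ↔ b.D 0 y ∈ b.row n ∧
    b.D 1 y ∈ Submodule.span k {b.x 0 ^ n} ∧
    ∃ r : k, b.g y = ε ^ (n + 1) • y + r • b.x 0 ^ (n + 1) := by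
  simp only [row, Submodule.mem_inf, Submodule.mem_comap, and_assoc, LinearMap.sub_apply,
    AlgHom.toLinearMap_apply, LinearMap.smul_apply, LinearMap.id_apply,
    Submodule.mem_span_singleton, eq_sub_iff_add_eq']
  simp only [eq_comm]

lemma row_mul_x0 {n : ℕ} {y : b.A} (hy : y ∈ b.row n) : y * b.x 0 ∈ b.row (n + 1) := by
  induction n generalizing y with
  | zero =>
    obtain ⟨r, rfl⟩ := Submodule.mem_span_singleton.1 hy
    rw [smul_mul_assoc, one_mul]
    refine Submodule.smul_mem _ _ (mem_row_succ.2 ⟨?_, ?_, 0, ?_⟩)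
    · rw [D_zero_x0]; exact Submodule.mem_span_singleton_self _
    · rw [D_one_x0]; exact Submodule.zero_mem _
    · rw [g_x0]; simp
  | succ n ih =>
    obtain ⟨h0, h1, r, hr⟩ := mem_row_succ.1 hy
    refine mem_row_succ.2 ⟨?_, ?_, ε * r, ?_⟩
    · rw [b.D_mul, D_zero_x0, mul_one, g_x0, mul_smul_comm]
      exact Submodule.add_mem _ (Submodule.smul_mem _ _ (ih h0)) hy
    · obtain ⟨s, hs⟩ := Submodule.mem_span_singleton.1 h1
      rw [b.D_mul, D_one_x0, mul_zero, add_zero, g_x0, ← hs, mul_smul_comm, smul_mul_assoc,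
        ← pow_succ]
      exact Submodule.smul_mem _ _ (Submodule.smul_mem _ _ (Submodule.mem_span_singleton_self _))
    · rw [map_mul, hr, g_x0, mul_smul_comm, add_mul, smul_mul_assoc, smul_mul_assoc, ← pow_succ]
      module

lemma x0_pow_mem_row (n : ℕ) : b.x 0 ^ n ∈ b.row n := by
  induction n with
  | zero => rw [pow_zero]; exact Submodule.mem_span_singleton_self _
  | succ n ih => rw [pow_succ]; exact row_mul_x0 ih

lemma x0_pow_mul_x1_mem_row (n : ℕ) : b.x 0 ^ n * b.x 1 ∈ b.row (n + 1) := by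
  have h1 : ∀ n : ℕ, b.D 1 (b.x 0 ^ n * b.x 1) ∈ Submodule.span k {b.x 0 ^ n} := fun n => by
    rw [b.D_mul, D_one_x0_pow, D_one_x1, zero_mul, zero_add, mul_one]
    exact Submodule.mem_span_singleton_self _
  have hg : ∀ n : ℕ, b.g (b.x 0 ^ n * b.x 1) =
      ε ^ (n + 1) • (b.x 0 ^ n * b.x 1) + ε ^ n • b.x 0 ^ (n + 1) := fun n => by
    rw [map_mul, g_x1, map_pow, g_x0, smul_pow, mul_add, smul_mul_smul_comm, smul_mul_assoc,
      ← pow_succ, ← pow_succ]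
  induction n with
  | zero =>
    refine mem_row_succ.2 ⟨?_, h1 0, _, hg 0⟩
    rw [pow_zero, one_mul, D_zero_x1]
    exact Submodule.zero_mem _
  | succ n ih =>
    refine mem_row_succ.2 ⟨?_, h1 _, _, hg _⟩
    rw [b.D_mul, D_zero_x1, mul_zero, add_zero, D_zero_x0_pow, g_x1, smul_mul_assoc, mul_add,
      mul_smul_comm, ← pow_succ]
    exact Submodule.smul_mem _ _ (Submodule.add_mem _ (Submodule.smul_mem _ _ ih)
      (x0_pow_mem_row _))

lemma word1_mem_row (n : ℕ) : b.word1 n ∈ b.row n := by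
  induction n with
  | zero => exact Submodule.zero_mem _
  | succ n ih => exact Submodule.add_mem _ (row_mul_x0 ih) (x0_pow_mul_x1_mem_row n)

lemma D_zero_word2 (n : ℕ) :
    ∃ t ∈ b.row n, b.D 0 (b.word2 (n + 1)) = qnum ε (n + 1) • b.word2 n + t := by
  induction n with
  | zero => exact ⟨0, Submodule.zero_mem _, by simp [word2, word1]⟩
  | succ n ih =>
    obtain ⟨t, ht, h⟩ := ih
    refine ⟨ε • (t * b.x 0) + qnum ε (n + 1) • (b.word1 n * b.x 0) +
      wordCoeff ε n • (ε • (b.x 0 ^ n * b.x 1) + b.x 0 ^ (n + 1)), ?_, ?_⟩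
    · exact Submodule.add_mem _ (Submodule.add_mem _ (Submodule.smul_mem _ _ (row_mul_x0 ht))
        (Submodule.smul_mem _ _ (row_mul_x0 (word1_mem_row n)))) (Submodule.smul_mem _ _
          (Submodule.add_mem _ (Submodule.smul_mem _ _ (x0_pow_mul_x1_mem_row n))
            (x0_pow_mem_row _)))
    · rw [word2, map_add, b.D_mul, b.D_mul, h, D_zero_x0, D_zero_x1, D_zero_word1, g_x0, g_x1,
        qnum_succ (n + 1), word2, pow_succ]
      simp only [smul_mul_assoc, mul_smul_comm, mul_zero, mul_one, add_zero, add_mul, mul_add]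
      module

lemma c_word1 (n : ℕ) : b.c (b.word1 n) = 0 := by
  cases n <;> simp [word1, b.c_x]

lemma c_word2 (n : ℕ) : b.c (b.word2 n) = 0 := by
  cases n <;> simp [word2, b.c_x]

end Sums

end Block

namespace Block

variable {k : Type u} [Field k] {ε : k} {b : Block k ε 2} {M : ℕ}

section Root

variable (hε : IsPrimitiveRoot ε (M + 2))

include hε

lemma qnum_ne_zero {n : ℕ} (h0 : 0 < n) (hn : n < M + 2) : qnum ε n ≠ 0 := fun h => by
  have := one_sub_mul_qnum (ε := ε) n
  rw [h, mul_zero] at this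
  exact hε.pow_ne_one_of_pos_of_lt h0.ne' hn (sub_eq_zero.1 this.symm).symm

lemma qnum_eq_zero : qnum ε (M + 2) = 0 := by
  have := one_sub_mul_qnum (ε := ε) (M + 2)
  rw [hε.pow_eq_one, sub_self, mul_eq_zero] at this
  refine this.resolve_left (sub_ne_zero.2 (hε.ne_one (by omega)).symm)

lemma wordCoeff_ne_zero [CharZero k] : wordCoeff ε (M + 1) ≠ 0 := by
  have h : ∀ n : ℕ, (1 - ε) * wordCoeff ε n = qnum ε (n + 1) - (n + 1 : ℕ) * ε ^ n := by
    intro n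
    induction n with
    | zero => simp [wordCoeff, qnum]
    | succ n ih =>
      rw [wordCoeff, mul_add, mul_left_comm, ih, one_sub_mul_qnum, qnum_succ (n + 1)]
      push_cast
      ring
  intro h0
  have := h (M + 1)
  rw [h0, qnum_eq_zero hε, mul_zero, zero_sub, zero_eq_neg] at this
  exact mul_ne_zero (Nat.cast_ne_zero.2 (by omega)) (pow_ne_zero _ (hε.ne_zero (by omega))) this

lemma x0_pow_eq_zero (hb : b.Nondegenerate) {n : ℕ} (hn : M + 2 ≤ n) : b.x 0 ^ n = 0 := by
  refine pow_eq_zero_of_le hn (hb.ext ?_ ?_ ?_)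
  · simp [b.c_x]
  · rw [D_zero_x0_pow, qnum_eq_zero hε, zero_smul, map_zero]
  · rw [D_one_x0_pow, map_zero]

lemma x0_pow_ne_zero {n : ℕ} (hn : n < M + 2) : b.x 0 ^ n ≠ 0 := by
  induction n with
  | zero =>
    intro h
    simpa using congrArg b.c h
  | succ n ih =>
    intro h
    have h' := D_zero_x0_pow (b := b) n
    rw [h, map_zero, eq_comm, smul_eq_zero] at h'
    exact h'.elim (qnum_ne_zero hε n.succ_pos hn) (ih (by omega))

variable [CharZero k] (hb : b.Nondegenerate)

include hb

lemma exists_D_zero_eq_x0_pow : ∃ d : b.A, b.D 0 d = b.x 0 ^ (M + 1) ∧ b.D 1 d = 0 ∧ b.g d = d ∧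
    b.c d = 0 ∧ d * b.x 0 = b.x 0 * d := by
  have h0 : b.D 0 ((wordCoeff ε (M + 1))⁻¹ • b.word1 (M + 2)) = b.x 0 ^ (M + 1) := by
    rw [map_smul, D_zero_word1, qnum_eq_zero hε, zero_smul, zero_add,
      inv_smul_smul₀ (wordCoeff_ne_zero hε)]
  have h1 : b.D 1 ((wordCoeff ε (M + 1))⁻¹ • b.word1 (M + 2)) = 0 := by
    rw [map_smul, D_one_word1, qnum_eq_zero hε, zero_smul, smul_zero]
  have hg : b.g ((wordCoeff ε (M + 1))⁻¹ • b.word1 (M + 2)) =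
      (wordCoeff ε (M + 1))⁻¹ • b.word1 (M + 2) := by
    rw [map_smul, g_word1, hε.pow_eq_one, x0_pow_eq_zero hε hb le_rfl, smul_zero, add_zero,
      one_smul]
  refine ⟨_, h0, h1, hg, by rw [map_smul, c_word1, smul_zero], hb.ext ?_ ?_ ?_⟩
  · simp [b.c_x]
  · rw [b.D_mul, b.D_mul, h0, hg, D_zero_x0, g_x0, mul_smul_comm, ← pow_succ, ← pow_succ',
      x0_pow_eq_zero hε hb le_rfl]
    simp
  · rw [b.D_mul, b.D_mul, h1, D_one_x0]
    simp

lemma exists_D_zero_eq_row_mul (n j : ℕ) (hnj : n + j = M + 1) {y : b.A} (hy : y ∈ b.row n) :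
    ∃ d : b.A, b.D 0 d = y * b.x 0 ^ j ∧ b.D 1 d ∈ Submodule.span k {b.x 0 ^ (M + 1)} ∧
      b.g d = d ∧ b.c d = 0 := by
  induction n generalizing j y with
  | zero =>
    obtain ⟨r, rfl⟩ := Submodule.mem_span_singleton.1 hy
    obtain ⟨d, h0, h1, hg, hc, -⟩ := exists_D_zero_eq_x0_pow hε hb
    refine ⟨r • d, ?_, ?_, ?_, ?_⟩
    · rw [map_smul, h0, smul_mul_assoc, one_mul, ← hnj, zero_add]
    · rw [map_smul, h1, smul_zero]
      exact Submodule.zero_mem _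
    · rw [map_smul, hg]
    · rw [map_smul, hc, smul_zero]
  | succ n ih =>
    obtain ⟨hy0, hy1, r, hr⟩ := mem_row_succ.1 hy
    obtain ⟨d, h0, h1, hg, hc⟩ := ih (j + 1) (by omega) hy0
    obtain ⟨s, hs⟩ := Submodule.mem_span_singleton.1 hy1
    refine ⟨(qnum ε (j + 1))⁻¹ • (y * b.x 0 ^ (j + 1) - ε ^ (j + 1) • d), ?_, ?_, ?_, ?_⟩
    · rw [map_smul, map_sub, map_smul, b.D_mul, g_x0_pow, h0, mul_smul_comm, add_sub_cancel_left,
        D_zero_x0_pow, mul_smul_comm, inv_smul_smul₀ (qnum_ne_zero hε j.succ_pos (by omega))]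
    · rw [map_smul, map_sub, map_smul, b.D_mul, D_one_x0_pow, g_x0_pow, mul_zero, add_zero, ← hs,
        smul_mul_smul_comm, ← pow_add, show n + (j + 1) = M + 1 by omega]
      exact Submodule.smul_mem _ _ (Submodule.sub_mem _ (Submodule.smul_mem _ _
        (Submodule.mem_span_singleton_self _)) (Submodule.smul_mem _ _ h1))
    · rw [map_smul, map_sub, map_smul, hg, map_mul, hr, g_x0_pow, mul_smul_comm, add_mul,
        smul_mul_assoc, smul_mul_assoc, ← pow_add,
        x0_pow_eq_zero hε hb (show M + 2 ≤ n + 1 + (j + 1) by omega), smul_zero, add_zero,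
        smul_smul, ← pow_add, show j + 1 + (n + 1) = M + 2 by omega, hε.pow_eq_one, one_smul]
    · simp [b.c_x, hc]

lemma exists_D_one_eq_x0_pow_succ : ∃ f : b.A, b.D 0 f = 0 ∧ b.D 1 f = b.x 0 ^ (M + 1) ∧
    b.c f = 0 := by
  obtain ⟨t, ht, h2⟩ := D_zero_word2 (b := b) (M + 1)
  rw [qnum_eq_zero hε, zero_smul, zero_add] at h2
  obtain ⟨d, h0, h1, hg, hc⟩ := exists_D_zero_eq_row_mul hε hb (M + 1) 0 rfl ht
  rw [pow_zero, mul_one] at h0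
  have hf0 : b.D 0 (b.word2 (M + 2) - d) = 0 := by rw [map_sub, h2, h0, sub_self]
  have hfc : b.c (b.word2 (M + 2) - d) = 0 := by rw [map_sub, c_word2, hc, sub_self]
  obtain ⟨γ, hγ⟩ : ∃ γ : k, b.D 1 (b.word2 (M + 2) - d) = γ • b.x 0 ^ (M + 1) := by
    obtain ⟨s, hs⟩ := Submodule.mem_span_singleton.1 h1
    rw [map_sub, D_one_word2, qnum_eq_zero hε, ← hs]
    exact ⟨wordCoeff ε (M + 1) - s, by module⟩
  have hγ0 : γ ≠ 0 := by
    rintro rfl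
    have hd : b.word2 (M + 2) = d := sub_eq_zero.1 (hb.ext (by rw [hfc, map_zero])
      (by rw [hf0, map_zero]) (by rw [hγ, zero_smul, map_zero]))
    obtain ⟨δ, hδ⟩ := g_word2 (b := b) (M + 1)
    rw [hd, hg, hε.pow_eq_one, one_smul, x0_pow_eq_zero hε hb le_rfl, smul_zero, add_zero,
      left_eq_add, smul_eq_zero] at hδ
    refine hδ.elim (mul_ne_zero (Nat.cast_ne_zero.2 (by omega))
      (pow_ne_zero _ (hε.ne_zero (by omega)))) fun h => ?_
    have hD := D_zero_word1 (b := b) (M + 1)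
    rw [h, map_zero, qnum_eq_zero hε, zero_smul, zero_add, eq_comm, smul_eq_zero] at hD
    exact hD.elim (wordCoeff_ne_zero hε) (x0_pow_ne_zero hε (by omega))
  exact ⟨γ⁻¹ • (b.word2 (M + 2) - d), by rw [map_smul, hf0, smul_zero],
    by rw [map_smul, hγ, inv_smul_smul₀ hγ0], by rw [map_smul, hfc, smul_zero]⟩

omit [CharZero k] hb in
lemma exists_D_one_eq_x0_pow : ∃ v : b.A, b.D 0 v = 0 ∧ b.D 1 v = b.x 0 ^ M ∧ b.c v = 0 := by
  obtain ⟨y, s, r, hr, h1, h0, hc⟩ : ∃ (y : b.A) (s r : k), r ≠ 0 ∧ b.D 1 y = r • b.x 0 ^ M ∧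
      b.D 0 y = s • b.x 0 ^ M ∧ b.c y = 0 := by
    have : ∀ n ≤ M, ∃ (y : b.A) (s r : k), r ≠ 0 ∧ b.D 1 y = r • b.x 0 ^ n ∧
        b.D 0 y = s • b.x 0 ^ n ∧ b.c y = 0 := by
      intro n hn
      induction n with
      | zero => exact ⟨b.x 1, 0, 1, one_ne_zero, by simp [b.D_x], by simp [b.D_x], b.c_x _⟩
      | succ n ih =>
        obtain ⟨y, s, r, hr, h1, h0, hc⟩ := ih (by omega)
        refine ⟨b.x 0 * y - b.g y * b.x 0, s - ε ^ (n + 1) * (ε * s + r),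
          r * (1 - ε ^ (n + 2)), mul_ne_zero hr (sub_ne_zero.2
            (hε.pow_ne_one_of_pos_of_lt (by omega) (by omega)).symm), ?_, ?_, by simp [b.c_x]⟩
        · rw [map_sub, b.D_mul, b.D_mul, D_one_g, h1, D_one_x0, map_smul, g_x0_pow, g_x0]
          simp only [smul_mul_assoc, mul_smul_comm, ← pow_succ, ← pow_succ']
          simp only [zero_mul, mul_zero, add_zero, zero_add]
          module
        · rw [map_sub, b.D_mul, b.D_mul, D_zero_g, h1, h0, D_zero_x0, map_add, map_smul, map_smul,
            map_smul, g_x0_pow, g_x0]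
          simp only [smul_mul_assoc, mul_smul_comm, add_mul, ← pow_succ, ← pow_succ']
          simp only [one_mul, mul_one]
          module
    exact this M le_rfl
  refine ⟨r⁻¹ • (y - (s / qnum ε (M + 1)) • b.x 0 ^ (M + 1)), ?_, ?_, ?_⟩
  · rw [map_smul, map_sub, h0, map_smul, D_zero_x0_pow, smul_smul,
      div_mul_cancel₀ _ (qnum_ne_zero hε M.succ_pos (by omega)), sub_self, smul_zero]
  · rw [map_smul, map_sub, h1, map_smul, D_one_x0_pow, smul_zero, sub_zero, inv_smul_smul₀ hr]
  · simp [hc, b.c_x]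

end Root

end Block

namespace Block

variable {k : Type u} [Field k] {ε : k} {b : Block k ε 2} {M : ℕ}

/-- A system of divided powers of the first point, where `ε` has order `M + 2`. -/
structure IsDividedPower (b : Block k ε 2) (M : ℕ) (e : ℕ → b.A) : Prop where
  zero : e 0 = 1
  D_zero : ∀ n, b.D 0 (e (n + 1)) = e n
  D_one : ∀ n, b.D 1 (e n) = 0
  c_succ : ∀ n, b.c (e (n + 1)) = 0
  g : ∀ n, b.g (e n) = ε ^ n • e n
  comm : ∀ m n, e m * e n = e n * e m
  mul_order : ∀ n, e n * e (M + 2) = ((n / (M + 2) + 1 : ℕ) : k) • e (n + (M + 2))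
  mul_pred : ∀ m n r, 0 < r → r < M + 2 →
    e (m * (M + 2) + r) * e (n * (M + 2) + (M + 1)) = 0
  eq_x0_pow : ∀ n < M + 2, ∃ r : k, e n = r • b.x 0 ^ n

lemma exists_isDividedPower [CharZero k] (hε : IsPrimitiveRoot ε (M + 2)) (hb : b.Nondegenerate) :
    ∃ e, b.IsDividedPower M e := by
  obtain ⟨d, hd0, hd1, hdg, hdc, hdx⟩ := exists_D_zero_eq_x0_pow hε hb
  have hcomm : Commute d (b.x 0) := hdx
  set q : ℕ → k := fun n => ∏ j ∈ Finset.range n, qnum ε (j + 1) with hq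
  have hqn : ∀ n < M + 2, q n ≠ 0 := fun n hn => Finset.prod_ne_zero_iff.2 fun j hj =>
    qnum_ne_zero hε j.succ_pos (by rw [Finset.mem_range] at hj; omega)
  have hqs : ∀ n, q (n + 1) = q n * qnum ε (n + 1) := fun n => Finset.prod_range_succ _ _
  set s : ℕ → ℕ → b.A := fun a r => ((q (M + 1) ^ a * a.factorial * q r)⁻¹ : k) •
    (d ^ a * b.x 0 ^ r) with hs
  have hdpow : ∀ a : ℕ, b.D 0 (d ^ (a + 1)) = (a + 1 : k) • (d ^ a * b.x 0 ^ (M + 1)) := by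
    intro a
    induction a with
    | zero => simp [hd0]
    | succ a ih =>
      rw [pow_succ d (a + 1), b.D_mul, ih, hd0, hdg, smul_mul_assoc, mul_assoc,
        ← (hcomm.pow_right (M + 1)).eq, ← mul_assoc, ← pow_succ]
      push_cast
      module
  have hdpow1 : ∀ a : ℕ, b.D 1 (d ^ a) = 0 := by
    intro a
    induction a with
    | zero => simp [D_one]
    | succ a ih => rw [pow_succ, b.D_mul, ih, hd1, zero_mul, mul_zero, add_zero]
  have hs_mul : ∀ a a' r r', s a r * s a' r' =
      ((q (M + 1) ^ a * a.factorial * q r)⁻¹ * (q (M + 1) ^ a' * a'.factorial * q r')⁻¹ : k) •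
        (d ^ (a + a') * b.x 0 ^ (r + r')) := by
    intro a a' r r'
    have h : d ^ a * b.x 0 ^ r * (d ^ a' * b.x 0 ^ r') = d ^ (a + a') * b.x 0 ^ (r + r') := by
      rw [mul_assoc, ← mul_assoc (b.x 0 ^ r), ← (hcomm.pow_pow a' r).eq, mul_assoc, ← mul_assoc,
        ← pow_add, ← pow_add]
    rw [hs]
    simp only
    rw [smul_mul_smul_comm, h]
  have hs_D : ∀ a r, r < M + 1 → b.D 0 (s a (r + 1)) = s a r := by
    intro a r hr
    have hr' : b.D 0 (d ^ a) * b.x 0 ^ (r + 1) = 0 := by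
      cases a with
      | zero => simp [D_one]
      | succ a =>
        rw [hdpow, smul_mul_assoc, mul_assoc, ← pow_add, x0_pow_eq_zero hε hb (by omega), mul_zero,
          smul_zero]
    rw [hs]
    simp only
    rw [map_smul, b.D_mul, g_x0_pow, mul_smul_comm, hr', smul_zero, zero_add, D_zero_x0_pow,
      mul_smul_comm, smul_smul, hqs r, ← mul_assoc, mul_inv _ (qnum ε (r + 1)),
      inv_mul_cancel_right₀ (qnum_ne_zero hε r.succ_pos (by omega))]
  have hs_D_succ : ∀ a, b.D 0 (s (a + 1) 0) = s a (M + 1) := by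
    intro a
    rw [hs]
    simp only
    rw [pow_zero, mul_one, map_smul, hdpow, smul_smul]
    congr 1
    have := Nat.cast_add_one_ne_zero (R := k) a
    have := Nat.cast_ne_zero (R := k).2 a.factorial_ne_zero
    have := hqn (M + 1) (by omega)
    rw [Nat.factorial_succ, pow_succ, show q 0 = 1 from rfl]
    push_cast
    field_simp
  have hdiv : ∀ a r, r < M + 2 → (a * (M + 2) + r) / (M + 2) = a := fun a r hr => by
    rw [mul_comm, Nat.mul_add_div (by omega), Nat.div_eq_of_lt hr, add_zero]
  have hmod : ∀ a r, r < M + 2 → (a * (M + 2) + r) % (M + 2) = r := fun a r hr => by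
    rw [mul_comm, Nat.mul_add_mod, Nat.mod_eq_of_lt hr]
  have hn : ∀ n, ∃ a r, r < M + 2 ∧ n = a * (M + 2) + r := fun n =>
    ⟨n / (M + 2), n % (M + 2), Nat.mod_lt _ (by omega), by rw [mul_comm, Nat.div_add_mod]⟩
  set e : ℕ → b.A := fun n => s (n / (M + 2)) (n % (M + 2))
  have he : ∀ a r, r < M + 2 → e (a * (M + 2) + r) = s a r := fun a r hr => by
    simp only [e, hdiv a r hr, hmod a r hr]
  have heN : e (M + 2) = s 1 0 := by
    have := he 1 0 (by omega)
    rwa [one_mul, add_zero] at this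
  refine ⟨e, ?_, ?_, ?_, ?_, ?_, ?_, ?_, ?_, ?_⟩
  · simp [e, hs, hq]
  · intro n
    obtain ⟨a, r, hr, rfl⟩ := hn n
    rcases Nat.lt_or_ge r (M + 1) with h | h
    · rw [add_assoc, he a r hr, he a (r + 1) (by omega), hs_D a r h]
    · obtain rfl : r = M + 1 := by omega
      rw [he a _ hr, show a * (M + 2) + (M + 1) + 1 = (a + 1) * (M + 2) + 0 by ring,
        he _ _ (by omega), hs_D_succ]
  · intro n
    simp only [e, hs]
    rw [map_smul, b.D_mul, hdpow1, D_one_x0_pow]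
    simp
  · intro n
    obtain ⟨a, r, hr, h⟩ := hn (n + 1)
    rw [h, he a r hr, hs]
    simp only
    rw [map_smul, map_mul, map_pow, map_pow, hdc, b.c_x]
    rcases Nat.eq_zero_or_pos a with rfl | ha
    · rw [zero_pow (n := r) (by omega), mul_zero, smul_zero]
    · rw [zero_pow ha.ne', zero_mul, smul_zero]
  · intro n
    obtain ⟨a, r, hr, rfl⟩ := hn n
    rw [he a r hr, hs]
    simp only
    rw [map_smul, map_mul, map_pow, hdg, g_x0_pow, mul_smul_comm, smul_comm, pow_add, mul_comm a,
      pow_mul, hε.pow_eq_one, one_pow, one_mul]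
  · intro m n
    simp only [e]
    rw [hs_mul, hs_mul, mul_comm, add_comm (m / _), add_comm (m % _)]
  · intro n
    obtain ⟨a, r, hr, rfl⟩ := hn n
    rw [heN, he a r hr, hdiv a r hr, show a * (M + 2) + r + (M + 2) = (a + 1) * (M + 2) + r by ring,
      he _ r hr, hs_mul, add_zero, hs]
    simp only
    rw [smul_smul]
    congr 1
    have := Nat.cast_add_one_ne_zero (R := k) a
    have := Nat.cast_ne_zero (R := k).2 a.factorial_ne_zero
    have := hqn (M + 1) (by omega)
    have := hqn r hr
    rw [Nat.factorial_succ a, pow_succ _ a, show q 0 = 1 from rfl, Nat.factorial_one, pow_one]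
    push_cast
    field_simp
  · intro m n r hr0 hr
    rw [he m r hr, he n (M + 1) (by omega), hs_mul, x0_pow_eq_zero hε hb (by omega), mul_zero,
      smul_zero]
  · intro n hnM
    refine ⟨(q n)⁻¹, ?_⟩
    have := he 0 n hnM
    rw [zero_mul, zero_add] at this
    rw [this, hs]
    simp

end Block

namespace Block

variable {k : Type u} [Field k] {ε : k} {b : Block k ε 2} {M : ℕ} {e : ℕ → b.A}

lemma exists_mem_fil (y : b.A) : ∃ n, y ∈ b.fil n := by
  induction y using b.induction with
  | hr r => exact ⟨0, by
      rw [Algebra.algebraMap_eq_smul_one]; exact Submodule.smul_mem _ _ (b.one_mem_fil 0)⟩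
  | hx i => exact ⟨1, b.x_mem_fil i⟩
  | hadd u v hu hv =>
    obtain ⟨m, hm⟩ := hu
    obtain ⟨n, hn⟩ := hv
    exact ⟨m + n, add_mem (b.fil_mono (m.le_add_right n) hm) (b.fil_mono (n.le_add_left m) hn)⟩
  | hmul u v hu hv =>
    obtain ⟨m, hm⟩ := hu
    obtain ⟨n, hn⟩ := hv
    exact ⟨m + n, mul_mem_fil hm hn rfl⟩

namespace IsDividedPower

lemma g_eq (he : b.IsDividedPower M e) (hb : b.Nondegenerate) {w : b.A} {a : ℕ} (h0 : b.D 0 w = 0)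
    (h1 : b.D 1 w = e a) (hc : b.c w = 0) :
    b.g w = ε ^ (a + 1) • w + ε ^ a • e (a + 1) := by
  apply hb.ext
  · simp [b.c_g, hc, he.c_succ]
  · rw [D_zero_g, h0, h1, smul_zero, zero_add, he.g, map_add, map_smul, map_smul, h0, he.D_zero,
      smul_zero, zero_add]
  · rw [D_one_g, h1, he.g, map_add, map_smul, map_smul, h1, he.D_one, smul_zero, add_zero,
      smul_smul, pow_succ']

lemma pow_smul_mul (he : b.IsDividedPower M e) (hε : IsPrimitiveRoot ε (M + 2)) (t : ℕ) :
    ε ^ t • (e t * e (M + 1)) = e t * e (M + 1) := by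
  have ht : t = t / (M + 2) * (M + 2) + t % (M + 2) := by rw [mul_comm, Nat.div_add_mod]
  rcases Nat.eq_zero_or_pos (t % (M + 2)) with h | h
  · rw [(hε.pow_eq_one_iff_dvd t).2 (Nat.dvd_of_mod_eq_zero h), one_smul]
  · have := he.mul_pred (t / (M + 2)) 0 _ h (Nat.mod_lt _ (by omega))
    rw [← ht, zero_mul, zero_add] at this
    rw [this, smul_zero]

lemma mul_sub_mul (he : b.IsDividedPower M e) (hε : IsPrimitiveRoot ε (M + 2))
    (hb : b.Nondegenerate) {f : b.A} (h0 : b.D 0 f = 0) (h1 : b.D 1 f = e (M + 1))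
    (hc : b.c f = 0) (t : ℕ) :
    e t * f - f * e t =
      (ε ^ (M + 1) * (∑ s ∈ Finset.range t, (s / (M + 2) + 1) : ℕ) : k) • e (t + (M + 2)) := by
  induction t with
  | zero => simp [he.zero]
  | succ t ih =>
    apply hb.ext
    · simp [hc, he.c_succ, show t + 1 + (M + 2) = t + (M + 2) + 1 by ring]
    · rw [map_sub, b.D_mul, b.D_mul, h0, he.D_zero, he.g_eq hb h0 h1 hc, map_smul,
        show t + 1 + (M + 2) = t + (M + 2) + 1 by ring, he.D_zero, hε.pow_eq_one, one_smul,
        mul_add, mul_smul_comm, he.mul_order, mul_zero, zero_mul, add_zero, zero_add,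
        add_sub_right_comm, ih, Finset.sum_range_succ]
      push_cast
      module
    · rw [map_sub, b.D_mul, b.D_mul, h1, he.D_one, he.g, map_smul, he.D_one, smul_zero, mul_zero,
        zero_mul, zero_add, add_zero, mul_smul_comm, he.comm (M + 1), he.pow_smul_mul hε, sub_self]

lemma pow_smul_mul_sub_mul (he : b.IsDividedPower M e) (hε : IsPrimitiveRoot ε (M + 2))
    (hb : b.Nondegenerate) {v : b.A} {m : ℕ} (h0 : b.D 0 v = 0)
    (h1 : b.D 1 v = e (m * (M + 2) + M)) (hc : b.c v = 0) {t : ℕ} (ht : t < M + 1) :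
    ε ^ (t + 1) • (e (t + 1) * v) - v * e (t + 1) =
      ε ^ (M + 1) • e (t + (m * (M + 2) + M + 2)) := by
  have hg : b.g v = ε ^ (M + 1) • v + ε ^ M • e (m * (M + 2) + (M + 1)) := by
    rw [he.g_eq hb h0 h1 hc, pow_succ, pow_add, mul_comm m, pow_mul, hε.pow_eq_one, one_pow,
      one_mul, pow_succ, add_assoc]
  have hN : ε ^ (M + 1) * ε = 1 := by rw [← pow_succ, hε.pow_eq_one]
  induction t with
  | zero =>
    apply hb.ext
    · simp [hc, he.c_succ, show 0 + (m * (M + 2) + M + 2) = m * (M + 2) + M + 1 + 1 by ring]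
    · rw [map_sub, map_smul, b.D_mul, b.D_mul, h0, he.D_zero, hg, he.zero, map_smul,
        show 0 + (m * (M + 2) + M + 2) = m * (M + 2) + (M + 1) + 1 by ring, he.D_zero, one_mul,
        mul_zero, zero_mul, add_zero, zero_add, mul_one, smul_add, smul_smul, smul_smul, zero_add,
        pow_one, mul_comm, hN, ← pow_succ', one_smul, add_sub_cancel_left]
    · rw [map_sub, map_smul, b.D_mul, b.D_mul, h1, he.D_one, he.g, map_smul, he.D_one,
        mul_smul_comm, he.comm (0 + 1)]
      simp
  | succ t ih =>
    have hp := he.mul_pred 0 m (t + 1) t.succ_pos (by omega)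
    rw [zero_mul, zero_add] at hp
    apply hb.ext
    · simp [hc, he.c_succ, show t + 1 + (m * (M + 2) + M + 2) = t + (m * (M + 2) + M + 2) + 1 by
        ring]
    · rw [map_sub, map_smul, b.D_mul, b.D_mul, h0, he.D_zero, hg, map_smul,
        show t + 1 + (m * (M + 2) + M + 2) = t + (m * (M + 2) + M + 2) + 1 by ring, he.D_zero,
        ← ih (by omega), mul_add, mul_smul_comm, mul_smul_comm, hp, smul_zero, mul_zero, add_zero,
        add_zero, zero_mul, zero_add, smul_smul, pow_succ ε (t + 1), mul_assoc, mul_comm ε, hN,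
        mul_one]
    · rw [map_sub, map_smul, b.D_mul, b.D_mul, h1, he.D_one, he.g, map_smul, he.D_one,
        mul_smul_comm, he.comm (t + 1 + 1)]
      simp

lemma D_one_commutator (he : b.IsDividedPower M e) (hε : IsPrimitiveRoot ε (M + 2))
    (hb : b.Nondegenerate) {f v : b.A} {m : ℕ} (hf0 : b.D 0 f = 0) (hf1 : b.D 1 f = e (M + 1))
    (hfc : b.c f = 0) (h0 : b.D 0 v = 0) (h1 : b.D 1 v = e (m * (M + 2) + M)) (hc : b.c v = 0) :
    b.D 1 (v * f - f * v) =
      (ε ^ (M + 1) * ((∑ s ∈ Finset.range (m * (M + 2) + M), (s / (M + 2) + 1)) + m : ℕ) : k) •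
        e ((m + 1) * (M + 2) + M) := by
  have hg : b.g v = ε ^ (M + 1) • v + ε ^ M • e (m * (M + 2) + (M + 1)) := by
    rw [he.g_eq hb h0 h1 hc, pow_succ, pow_add, mul_comm m, pow_mul, hε.pow_eq_one, one_pow,
      one_mul, pow_succ, add_assoc]
  have hgf : b.g f = f + ε ^ (M + 1) • e (M + 2) := by
    rw [he.g_eq hb hf0 hf1 hfc, hε.pow_eq_one, one_smul]
  have hp := he.mul_pred 0 m (M + 1) M.succ_pos (by omega)
  rw [zero_mul, zero_add] at hp
  have hX := he.pow_smul_mul_sub_mul hε hb h0 h1 hc M.lt_succ_self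
  have hE := he.mul_sub_mul hε hb hf0 hf1 hfc (m * (M + 2) + M)
  have hO := he.mul_order (m * (M + 2) + M)
  rw [show (m * (M + 2) + M) / (M + 2) = m by
    rw [mul_comm, Nat.mul_add_div (by omega), Nat.div_eq_of_lt (by omega), add_zero]] at hO
  rw [show M + (m * (M + 2) + M + 2) = (m + 1) * (M + 2) + M by ring] at hX
  rw [show m * (M + 2) + M + (M + 2) = (m + 1) * (M + 2) + M by ring] at hE hO
  rw [map_sub, b.D_mul, b.D_mul, hf1, h1, hg, hgf, mul_add,
    mul_add (e _) (_ • v), mul_smul_comm, mul_smul_comm, mul_smul_comm, hp, smul_zero,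
    add_zero, hO, eq_add_of_sub_eq hE, eq_add_of_sub_eq hX]
  push_cast
  module

lemma exists_D_one_eq [CharZero k] (he : b.IsDividedPower M e) (hε : IsPrimitiveRoot ε (M + 2))
    (hb : b.Nondegenerate) (hM : 0 < M) :
    ∃ C, ∀ m, ∃ v, b.D 0 v = 0 ∧ b.D 1 v = e (m * (M + 2) + M) ∧ b.c v = 0 ∧
      v ∈ b.fil (C * (m + 1)) := by
  have key : ∀ n < M + 2, ∀ w, b.D 0 w = 0 → b.D 1 w = b.x 0 ^ n → b.c w = 0 →
      ∃ w, b.D 0 w = 0 ∧ b.D 1 w = e n ∧ b.c w = 0 := by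
    intro n hn w h0 h1 hc
    obtain ⟨r, hr⟩ := he.eq_x0_pow n hn
    exact ⟨r • w, by rw [map_smul, h0, smul_zero], by rw [map_smul, h1, hr],
      by rw [map_smul, hc, smul_zero]⟩
  obtain ⟨f, hf0, hf1, hfc⟩ : ∃ w, b.D 0 w = 0 ∧ b.D 1 w = e (M + 1) ∧ b.c w = 0 := by
    obtain ⟨w, h0, h1, hc⟩ := exists_D_one_eq_x0_pow_succ hε hb
    exact key _ (by omega) w h0 h1 hc
  obtain ⟨v, hv0, hv1, hvc⟩ : ∃ w, b.D 0 w = 0 ∧ b.D 1 w = e M ∧ b.c w = 0 := by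
    obtain ⟨w, h0, h1, hc⟩ := exists_D_one_eq_x0_pow (b := b) hε
    exact key _ (by omega) w h0 h1 hc
  obtain ⟨p, hp⟩ := exists_mem_fil f
  obtain ⟨q, hq⟩ := exists_mem_fil v
  have hf := b.fil_mono (p.le_add_right q) hp
  refine ⟨p + q, fun m => ?_⟩
  induction m with
  | zero => exact ⟨v, hv0, by rw [hv1, zero_mul, zero_add], hvc,
      b.fil_mono (by omega) hq⟩
  | succ m ih =>
    obtain ⟨w, hw0, hw1, hwc, hw⟩ := ih
    have hD := he.D_one_commutator hε hb hf0 hf1 hfc hw0 hw1 hwc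
    set r : k := ε ^ (M + 1) *
      ((∑ s ∈ Finset.range (m * (M + 2) + M), (s / (M + 2) + 1)) + m : ℕ) with hr
    have hr0 : r ≠ 0 := by
      refine mul_ne_zero (pow_ne_zero _ (hε.ne_zero (by omega))) (Nat.cast_ne_zero.2 ?_)
      have : 0 < ∑ s ∈ Finset.range (m * (M + 2) + M), (s / (M + 2) + 1) :=
        Finset.sum_pos (fun _ _ => Nat.succ_pos _) ⟨0, Finset.mem_range.2 (by omega)⟩
      omega
    refine ⟨r⁻¹ • (w * f - f * w), ?_, ?_, ?_, ?_⟩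
    · rw [map_smul, map_sub, b.D_mul, b.D_mul, hw0, hf0]
      simp
    · rw [map_smul, hD, inv_smul_smul₀ hr0]
    · simp [hfc]
    · exact Submodule.smul_mem _ _ (sub_mem (mul_mem_fil hw hf (by ring))
        (mul_mem_fil hf hw (by ring)))

end IsDividedPower

end Block

namespace Block

variable {k : Type u} [Field k] {ε : k} {b : Block k ε 2} {M : ℕ} {e : ℕ → b.A}

/-- The elements killed by any composition of derivations in which `D 1` occurs `r` times. -/
def order (b : Block k ε 2) : ℕ → Submodule k b.A
  | 0 => ⊥
  | r + 1 => ⨅ n : ℕ, (order b r).comap (b.D 1 ∘ₗ (b.D 0 ^ n))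

lemma mem_order_succ {r : ℕ} {y : b.A} :
    y ∈ b.order (r + 1) ↔ ∀ n : ℕ, b.D 1 ((b.D 0 ^ n) y) ∈ b.order r := by
  simp [order, Submodule.mem_iInf]

lemma eq_zero_of_mem_order_zero {y : b.A} (hy : y ∈ b.order 0) : y = 0 := hy

lemma D_zero_mem_order {r : ℕ} {y : b.A} (hy : y ∈ b.order r) : b.D 0 y ∈ b.order r := by
  cases r with
  | zero => rw [eq_zero_of_mem_order_zero hy, map_zero]; exact Submodule.zero_mem _
  | succ r =>
    exact mem_order_succ.2 fun n => by
      have h := mem_order_succ.1 hy (n + 1)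
      rwa [pow_succ, Module.End.mul_apply] at h

lemma D_zero_pow_mem_order {r : ℕ} {y : b.A} (hy : y ∈ b.order r) (n : ℕ) :
    (b.D 0 ^ n) y ∈ b.order r := by
  induction n with
  | zero => exact hy
  | succ n ih => rw [pow_succ', Module.End.mul_apply]; exact D_zero_mem_order ih

lemma D_one_mem_order {r : ℕ} {y : b.A} (hy : y ∈ b.order (r + 1)) : b.D 1 y ∈ b.order r :=
  mem_order_succ.1 hy 0

lemma mem_order_of_D {r : ℕ} {y : b.A} (h0 : b.D 0 y ∈ b.order (r + 1))
    (h1 : b.D 1 y ∈ b.order r) : y ∈ b.order (r + 1) :=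
  mem_order_succ.2 fun n => by
    cases n with
    | zero => exact h1
    | succ n => rw [pow_succ, Module.End.mul_apply]; exact mem_order_succ.1 h0 n

variable (b) in
lemma order_mono : Monotone b.order := by
  refine monotone_nat_of_le_succ fun r => ?_
  induction r with
  | zero => exact bot_le
  | succ r ih => exact fun y hy => mem_order_succ.2 fun n => ih (mem_order_succ.1 hy n)

lemma g_mem_order {r : ℕ} {y : b.A} (hy : y ∈ b.order r) : b.g y ∈ b.order r := by
  induction r generalizing y with
  | zero => rw [eq_zero_of_mem_order_zero hy, map_zero]; exact Submodule.zero_mem _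
  | succ r ih =>
    refine mem_order_succ.2 fun n => ?_
    induction n generalizing y with
    | zero =>
      rw [pow_zero, Module.End.one_apply, D_one_g]
      exact Submodule.smul_mem _ _ (ih (D_one_mem_order hy))
    | succ n ihn =>
      rw [pow_succ, Module.End.mul_apply, D_zero_g]
      exact ihn (add_mem (Submodule.smul_mem _ _ (D_zero_mem_order hy))
        (b.order_mono r.le_succ (D_one_mem_order hy)))

lemma mul_mem_order {p q r : ℕ} {u v : b.A} (hu : u ∈ b.order p) (hv : v ∈ b.order q)
    (h : p + q ≤ r + 1) : u * v ∈ b.order r := by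
  induction r generalizing p q u v with
  | zero =>
    have h' : p = 0 ∨ q = 0 := by omega
    rcases h' with rfl | rfl
    · rw [eq_zero_of_mem_order_zero hu, zero_mul]; exact Submodule.zero_mem _
    · rw [eq_zero_of_mem_order_zero hv, mul_zero]; exact Submodule.zero_mem _
  | succ r ih =>
    refine mem_order_succ.2 fun n => ?_
    induction n generalizing u v with
    | zero =>
      rw [pow_zero, Module.End.one_apply, b.D_mul]
      refine add_mem ?_ ?_
      · cases p with
        | zero =>
          rw [eq_zero_of_mem_order_zero hu, map_zero, zero_mul]; exact Submodule.zero_mem _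
        | succ p => exact ih (D_one_mem_order hu) (g_mem_order hv) (by omega)
      · cases q with
        | zero =>
          rw [eq_zero_of_mem_order_zero hv, map_zero, mul_zero]; exact Submodule.zero_mem _
        | succ q => exact ih hu (D_one_mem_order hv) (by omega)
    | succ n ihn =>
      rw [pow_succ, Module.End.mul_apply, b.D_mul, map_add, map_add]
      exact add_mem (ihn (D_zero_mem_order hu) (g_mem_order hv)) (ihn hu (D_zero_mem_order hv))

lemma one_mem_order : (1 : b.A) ∈ b.order 1 :=
  mem_order_of_D (by rw [D_one]; exact Submodule.zero_mem _)
    (by rw [D_one]; exact Submodule.zero_mem _)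

lemma iterate_g_mem_order {r : ℕ} {y : b.A} (hy : y ∈ b.order r) (n : ℕ) :
    b.g^[n] y ∈ b.order r := by
  induction n with
  | zero => exact hy
  | succ n ih => rw [Function.iterate_succ_apply']; exact g_mem_order ih

lemma D_zero_pow_mul {p w : b.A} {r : ℕ} (hp : p ∈ b.order r) (h0 : b.D 0 w ∈ b.order 1)
    (h1 : b.D 1 w ∈ b.order 1) (n : ℕ) :
    (b.D 0 ^ n) (p * w) - (b.D 0 ^ n) p * b.g^[n] w ∈ b.order r := by
  induction n generalizing p w with
  | zero => simp
  | succ n ih =>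
    rw [pow_succ, Module.End.mul_apply, Module.End.mul_apply, b.D_mul, map_add,
      Function.iterate_succ_apply, add_sub_right_comm]
    refine add_mem (ih (D_zero_mem_order hp) ?_ ?_)
      (D_zero_pow_mem_order (mul_mem_order hp h0 le_rfl) n)
    · rw [D_zero_g]
      exact g_mem_order (add_mem (Submodule.smul_mem _ _ h0) h1)
    · rw [D_one_g]
      exact Submodule.smul_mem _ _ (g_mem_order h1)

lemma D_zero_pow_mul_of_D_zero_eq_zero {y : b.A} (hy : b.D 0 y = 0) (u : b.A) (n : ℕ) :
    (b.D 0 ^ n) (y * u) = y * (b.D 0 ^ n) u := by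
  induction n generalizing u with
  | zero => rfl
  | succ n ih =>
    rw [pow_succ, Module.End.mul_apply, Module.End.mul_apply, b.D_mul, hy, zero_mul, zero_add, ih]

/-- The properties shared by the elements of a chain. -/
structure IsTame (b : Block k ε 2) (t r : ℕ) (y : b.A) : Prop where
  D_zero : b.D 0 y = 0
  mem : y ∈ b.order (r + 1)
  D_zero_pow_D_one : ∀ n, t ≤ n → ∀ s, r ≤ s + 1 → (b.D 0 ^ n) (b.D 1 y) ∈ b.order s

lemma IsTame.D_zero_pow_D_one_mul {t r : ℕ} {y w : b.A} (hy : b.IsTame t r y)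
    (h0 : b.D 0 w = 0) (h1 : b.D 1 w ∈ b.order 1) {n : ℕ} (hn : t ≤ n) :
    (b.D 0 ^ n) (b.D 1 y * b.g w) ∈ b.order r := by
  cases r with
  | zero =>
    rw [eq_zero_of_mem_order_zero (D_one_mem_order hy.mem), zero_mul, map_zero]
    exact Submodule.zero_mem _
  | succ r =>
    have hw : w ∈ b.order 2 := mem_order_of_D (by rw [h0]; exact Submodule.zero_mem _) h1
    have h := D_zero_pow_mul (w := b.g w) (D_one_mem_order hy.mem)
      (by rw [D_zero_g, h0, smul_zero, zero_add]; exact g_mem_order h1)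
      (by rw [D_one_g]; exact Submodule.smul_mem _ _ (g_mem_order h1)) n
    rw [← sub_add_cancel ((b.D 0 ^ n) _) ((b.D 0 ^ n) (b.D 1 y) * b.g^[n] (b.g w))]
    exact add_mem h (mul_mem_order (hy.D_zero_pow_D_one n hn r le_rfl)
      (iterate_g_mem_order (g_mem_order hw) n) le_rfl)

namespace IsDividedPower

lemma mem_order (he : b.IsDividedPower M e) (n : ℕ) : e n ∈ b.order 1 := by
  induction n with
  | zero => rw [he.zero]; exact one_mem_order
  | succ n ih =>
    exact mem_order_of_D (by rwa [he.D_zero]) (by rw [he.D_one]; exact Submodule.zero_mem _)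

lemma D_zero_pow_self (he : b.IsDividedPower M e) (n : ℕ) : (b.D 0 ^ n) (e n) = 1 := by
  induction n with
  | zero => exact he.zero
  | succ n ih => rw [pow_succ, Module.End.mul_apply, he.D_zero, ih]

lemma D_zero_pow_of_lt (he : b.IsDividedPower M e) {m n : ℕ} (h : m < n) :
    (b.D 0 ^ n) (e m) = 0 := by
  obtain ⟨d, rfl⟩ := Nat.exists_eq_add_of_lt h
  rw [show m + d + 1 = d + 1 + m by ring, pow_add, Module.End.mul_apply, he.D_zero_pow_self,
    pow_succ, Module.End.mul_apply, b.D_one, map_zero]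

lemma isTame_of_mem_chain (he : b.IsDividedPower M e) {z : ℕ → b.A} {a : ℕ → ℕ}
    (ha : StrictMono a) (hz0 : ∀ m, b.D 0 (z m) = 0) (hz1 : ∀ m, b.D 1 (z m) = e (a m))
    {m r : ℕ} {y : b.A} (hy : y ∈ chain z m r) : b.IsTame (a m) r y := by
  refine chain_induction (P := fun m r y => b.IsTame (a m) r y) (fun m t => ?_) (fun m r => ?_)
    (fun m r u v hu hv _ => ?_) hy
  · refine ⟨by rw [map_smul, b.D_one, smul_zero], Submodule.smul_mem _ _ one_mem_order,
      fun n _ s _ => ?_⟩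
    rw [map_smul, b.D_one, smul_zero, map_zero]
    exact Submodule.zero_mem _
  · refine ⟨map_zero _, Submodule.zero_mem _, fun n _ s _ => ?_⟩
    rw [map_zero, map_zero]
    exact Submodule.zero_mem _
  · have hz : z m ∈ b.order 2 := mem_order_of_D (by rw [hz0]; exact Submodule.zero_mem _)
      (by rw [hz1]; exact he.mem_order _)
    have ham : a m < a (m + 1) := ha m.lt_succ_self
    refine ⟨?_, add_mem hu.mem (mul_mem_order hv.mem hz (by omega)), fun n hn s hs => ?_⟩
    · rw [map_add, b.D_mul, hu.D_zero, hv.D_zero, hz0, zero_mul, mul_zero, add_zero, add_zero]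
    · rw [map_add, b.D_mul, hz1, map_add, map_add, D_zero_pow_mul_of_D_zero_eq_zero hv.D_zero,
        he.D_zero_pow_of_lt (by omega), mul_zero, add_zero]
      exact add_mem (hu.D_zero_pow_D_one n (by omega) s (by omega))
        (b.order_mono (by omega) (hv.D_zero_pow_D_one_mul (hz0 m)
          (by rw [hz1]; exact he.mem_order _) (by omega)))

end IsDividedPower

theorem GKdim_eq_top_of_isPrimitiveRoot [CharZero k] (hε : IsPrimitiveRoot ε (M + 2))
    (hM : 0 < M) (hb : b.Nondegenerate) : GKdim k b.A = ⊤ := by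
  obtain ⟨e, he⟩ := exists_isDividedPower hε hb
  obtain ⟨C, hC⟩ := he.exists_D_one_eq hε hb hM
  choose z hz0 hz1 _ hz using hC
  have ha : StrictMono fun m => m * (M + 2) + M :=
    strictMono_nat_of_lt_succ fun m => by rw [add_mul]; omega
  have tame : ∀ m r, ∀ y ∈ chain z m r, b.IsTame (m * (M + 2) + M) r y := fun m r y hy =>
    he.isTame_of_mem_chain ha hz0 hz1 hy
  refine GKdim_eq_top_of_chain (z := z) (W := b.order)
    (Δ := fun m => (b.D 0 ^ (m * (M + 2) + M)) * b.D 1) (γ := fun _ => 1)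
    (fun _ => one_ne_zero) ?_ ?_ ?_ ?_ hz
  · intro h
    have := congrArg b.c (eq_zero_of_mem_order_zero h)
    rw [map_one, map_zero] at this
    exact one_ne_zero this
  · intro m r y hy
    exact D_zero_pow_mem_order (D_one_mem_order hy) _
  · intro m r y hy
    exact (tame m _ y hy).D_zero_pow_D_one _ le_rfl r le_rfl
  · intro m r y hy
    have hy' := tame m r y hy
    rw [Module.End.mul_apply, b.D_mul, map_add, hz1,
      D_zero_pow_mul_of_D_zero_eq_zero hy'.D_zero, he.D_zero_pow_self, mul_one, one_smul,
      add_sub_cancel_right]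
    exact hy'.D_zero_pow_D_one_mul (hz0 m) (by rw [hz1]; exact he.mem_order _) le_rfl

end Block

theorem GKdim_nichols_eq_top {k : Type*} [Field k] [CharZero k] {ℓ : ℕ} (hℓ : 2 ≤ ℓ) {ε : k}
    {D : Fin ℓ → (FreeAlgebra k (Fin ℓ) →ₗ[k] FreeAlgebra k (Fin ℓ))}
    (hDx : ∀ i j, D i (FreeAlgebra.ι k j) = if i = j then 1 else 0)
    (hDmul : ∀ i (u v : FreeAlgebra k (Fin ℓ)),
      D i (u * v) = D i u * blockAut k ℓ ε v + u * D i v)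
    (h : ¬(ℓ = 2 ∧ (ε = 1 ∨ ε = -1))) : GKdim k (RingQuot (nicholsRel D)) = ⊤ := by
  rw [← top_le_iff]
  have hr3 : ε = 1 ∨ ε = -1 → 3 ≤ ℓ := fun hε => by
    by_contra hlt
    exact h ⟨by omega, hε⟩
  by_cases h1 : ε = 1
  · obtain ⟨b, -, hle⟩ := Block.exists_nondegenerate D hDx hDmul (hr3 (Or.inl h1))
    subst h1
    rwa [b.GKdim_eq_top_of_one] at hle
  by_cases h2 : ε = -1
  · obtain ⟨b, -, hle⟩ := Block.exists_nondegenerate D hDx hDmul (hr3 (Or.inr h2))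
    subst h2
    rwa [b.GKdim_eq_top_of_neg_one] at hle
  obtain ⟨b, hb, hle⟩ := Block.exists_nondegenerate D hDx hDmul hℓ
  by_cases hε : ∀ n, 0 < n → ε ^ n ≠ 1
  · rwa [b.GKdim_eq_top_of_pow_ne_one hε] at hle
  · push Not at hε
    obtain ⟨n, hn, hεn⟩ := hε
    have hroot := IsPrimitiveRoot.orderOf ε
    have h0 : orderOf ε ≠ 0 := (orderOf_pos_iff.2 (isOfFinOrder_iff_pow_eq_one.2 ⟨n, hn, hεn⟩)).ne'
    have ho1 : orderOf ε ≠ 1 := fun h => h1 (orderOf_eq_one_iff.1 h)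
    have ho2 : orderOf ε ≠ 2 := fun h => by
      have := pow_orderOf_eq_one ε
      rw [h] at this
      exact (sq_eq_one_iff.1 this).elim h1 h2
    obtain ⟨M, hM⟩ : ∃ M, orderOf ε = M + 2 := ⟨orderOf ε - 2, by omega⟩
    rw [hM] at hroot
    rwa [Block.GKdim_eq_top_of_isPrimitiveRoot hroot (by omega) hb] at hle

theorem GKdim_nichols_eq_two {k : Type*} [Field k] [CharZero k] {ε : k}
    {D : Fin 2 → (FreeAlgebra k (Fin 2) →ₗ[k] FreeAlgebra k (Fin 2))}
    (hDx : ∀ i j, D i (FreeAlgebra.ι k j) = if i = j then 1 else 0)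
    (hDmul : ∀ i (u v : FreeAlgebra k (Fin 2)),
      D i (u * v) = D i u * blockAut k 2 ε v + u * D i v)
    (hε : ε = 1 ∨ ε = -1) : GKdim k (RingQuot (nicholsRel D)) = 2 := by
  obtain ⟨b, hb, hle⟩ := Block.exists_nondegenerate D hDx hDmul le_rfl
  rcases hε with hε | hε
  · refine le_antisymm (GKdim_nichols_one_le_two hDx hDmul hε) ?_
    subst hε
    exact Block.two_le_GKdim_jordan.trans hle
  · refine le_antisymm (GKdim_nichols_neg_one_le_two hDx hDmul hε) ?_
    subst hε
    exact (Block.two_le_GKdim_superJordan hb).trans hle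

/-- `GKdim B(V(ε,ℓ)) < ∞ ↔ ℓ = 2 and ε = ±1`; and in that case the
Gelfand–Kirillov dimension equals `2`. -/
theorem statement0 (k : Type*) [Field k] [IsAlgClosed k] [CharZero k]
    (ℓ : ℕ) (hℓ : 2 ≤ ℓ) (ε : k) (hε : ε ≠ 0)
    (D : Fin ℓ → (FreeAlgebra k (Fin ℓ) →ₗ[k] FreeAlgebra k (Fin ℓ)))
    (hD1 : ∀ i, D i (1 : FreeAlgebra k (Fin ℓ)) = 0)
    (hDx : ∀ i j, D i (FreeAlgebra.ι k j) = if i = j then 1 else 0)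
    (hDmul : ∀ i (u v : FreeAlgebra k (Fin ℓ)),
      D i (u * v) = D i u * blockAut k ℓ ε v + u * D i v) :
    (GKdim k (RingQuot (nicholsRel D)) < ⊤ ↔ ℓ = 2 ∧ (ε = 1 ∨ ε = -1)) ∧
    (ℓ = 2 → (ε = 1 ∨ ε = -1) → GKdim k (RingQuot (nicholsRel D)) = 2) := by
  have h2 : ℓ = 2 → (ε = 1 ∨ ε = -1) → GKdim k (RingQuot (nicholsRel D)) = 2 := by
    rintro rfl h
    exact GKdim_nichols_eq_two hDx hDmul h
  refine ⟨⟨fun h => ?_, fun h => ?_⟩, h2⟩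
  · by_contra h'
    exact h.ne (GKdim_nichols_eq_top hℓ hDx hDmul h')
  · rw [h2 h.1 h.2]
    exact ENNReal.ofNat_lt_top
end

section
/- Let k be a field and let B = ⊕_{n≥0} B_n be an ℕ-graded k-algebra (B_i·B_j ⊆ B_{i+j}) that is finitely generated as a k-algebra and satisfies B_0 = k·1. Suppose there exist m, p ∈ ℕ and a sequence (y_i)_{i∈ℕ} of homogeneous elements of B with deg y_i ≤ m·i + p for all i, such that the family of all ordered products y_{i_1}·y_{i_2}·⋯·y_{i_l}, indexed by the finite strictly increasing sequences i_1 < i_2 < ⋯ < i_l of natural numbers, is linearly independent over k. Then GKdim B = ∞. -/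
open scoped ENNReal

open Filter

/-- In a graded algebra with `𝒜 0 = k·1`, a subspace containing `1` and all homogeneous components
of a generating set has the property that its `n`-th power contains the degree `n` component. -/
theorem homogeneous_le_pow {k B : Type*} [Field k] [Ring B] [Algebra k B]
    (𝒜 : ℕ → Submodule k B) [GradedAlgebra 𝒜] (h0 : 𝒜 0 = 1) (S : Set B)
    (hS : Algebra.adjoin k S = ⊤) (V : Submodule k B) (h1 : 1 ≤ V)
    (hV : ∀ s ∈ S, ∀ n, (DirectSum.decompose 𝒜 s n : B) ∈ V) (n : ℕ) :
    𝒜 n ≤ V ^ n := by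
  have one_mem : ∀ n, (1 : B) ∈ V ^ n := fun n =>
    Submodule.one_le.mp (one_le_pow_of_one_le' h1 n)
  have zero_le : 𝒜 0 ≤ V ^ 0 := by rw [h0, pow_zero]
  have key : ∀ b : B, ∀ n, (DirectSum.decompose 𝒜 b n : B) ∈ V ^ n := by
    intro b
    have hb : b ∈ Algebra.adjoin k S := hS ▸ Algebra.mem_top
    induction hb using Algebra.adjoin_induction with
    | mem x hx =>
      intro n
      rcases Nat.eq_zero_or_pos n with rfl | hn
      · exact zero_le (SetLike.coe_mem _)
      · exact le_self_pow h1 hn.ne' (hV x hx n)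
    | algebraMap r =>
      intro n
      rcases Nat.eq_zero_or_pos n with rfl | hn
      · exact zero_le (SetLike.coe_mem _)
      · rw [DirectSum.decompose_of_mem_ne 𝒜 (SetLike.algebraMap_mem_graded 𝒜 r) hn.ne]
        exact zero_mem _
    | add x y _ _ hx hy =>
      intro n
      rw [DirectSum.decompose_add, DirectSum.add_apply, Submodule.coe_add]
      exact add_mem (hx n) (hy n)
    | mul x y _ _ hx hy =>
      intro n
      classical
      rw [DirectSum.decompose_mul, DirectSum.coe_mul_apply]
      refine sum_mem fun ij hij => ?_
      rw [← (Finset.mem_filter.mp hij).2, pow_add]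
      exact Submodule.mul_mem_mul (hx _) (hy _)
  intro b hb
  simpa only [DirectSum.decompose_of_mem_same 𝒜 hb] using key b n

/-- A connected finitely generated graded algebra has a finite-dimensional subspace `V ∋ 1` such
that `V ^ n` contains the degree `n` component for every `n`. -/
theorem exists_finiteDimensional_homogeneous_le_pow {k B : Type*} [Field k] [Ring B] [Algebra k B]
    (𝒜 : ℕ → Submodule k B) [GradedAlgebra 𝒜] (h0 : 𝒜 0 = 1) (hfg : Algebra.FiniteType k B) :
    ∃ V : Submodule k B, FiniteDimensional k V ∧ 1 ≤ V ∧ ∀ n, 𝒜 n ≤ V ^ n := by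
  classical
  obtain ⟨S, hS⟩ := hfg.out
  let T : Finset B := insert 1 (S.biUnion fun s =>
    (DirectSum.decompose 𝒜 s).support.image fun n => (DirectSum.decompose 𝒜 s n : B))
  have h1 : (1 : Submodule k B) ≤ Submodule.span k (T : Set B) :=
    Submodule.one_le.mpr (Submodule.subset_span (by simp [T]))
  refine ⟨Submodule.span k (T : Set B), FiniteDimensional.span_finset k T, h1,
    homogeneous_le_pow 𝒜 h0 S hS _ h1 fun s hs n => ?_⟩
  by_cases hn : DirectSum.decompose 𝒜 s n = 0
  · rw [hn]
    exact zero_mem _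
  · refine Submodule.subset_span (Finset.mem_coe.mpr (Finset.mem_insert_of_mem ?_))
    exact Finset.mem_biUnion.mpr ⟨s, hs, Finset.mem_image.mpr
      ⟨n, DFinsupp.mem_support_iff.mpr hn, rfl⟩⟩

/-- If the growth of `V` at `C * N ^ 2` is at least `2 ^ N` for every `N`, the Gelfand–Kirillov
dimension is infinite. -/
theorem GKdim_eq_top_of_two_pow_le {k A : Type*} [Field k] [Ring A] [Algebra k A]
    (V : Submodule k A) [hV : FiniteDimensional k V] (C : ℕ) (hC : 1 ≤ C)
    (h : ∀ N : ℕ, 2 ^ N ≤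
      Module.finrank k (↥(∑ j ∈ Finset.range (C * N ^ 2 + 1), V ^ j))) :
    GKdim k A = ⊤ := by
  refine ENNReal.eq_top_of_forall_nnreal_le fun r => ?_
  refine le_trans ?_ (le_iSup₂_of_le V hV le_rfl)
  refine le_limsup_of_frequently_le' ?_
  have hlim : Tendsto (fun N : ℕ => C * N ^ 2) atTop atTop :=
    tendsto_atTop_mono (fun N =>
      (Nat.le_self_pow two_ne_zero N).trans (Nat.le_mul_of_pos_left _ hC)) tendsto_id
  refine hlim.frequently (Eventually.frequently ?_)
  have hlog : ∀ᶠ N : ℕ in atTop,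
      (r : ℝ) * (Real.log C + 2 * Real.log N) ≤ N * Real.log 2 := by
    have hc : 0 < Real.log 2 / 2 := by positivity
    have hl : (fun x : ℝ => (r : ℝ) * (Real.log C + 2 * Real.log x)) =o[atTop] (id : ℝ → ℝ) :=
      ((Asymptotics.isLittleO_const_id_atTop _).add
        (Real.isLittleO_log_id_atTop.const_mul_left _)).const_mul_left _
    have := (hl.comp_tendsto tendsto_natCast_atTop_atTop).bound (Real.log_pos one_lt_two)
    filter_upwards [this] with N hN
    simpa [mul_comm] using (le_abs_self _).trans hN
  filter_upwards [hlog, eventually_ge_atTop 2] with N hN hN2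
  rw [← ENNReal.ofReal_coe_nnreal]
  refine ENNReal.ofReal_le_ofReal ?_
  have hCpos : (0 : ℝ) < C := by exact_mod_cast hC
  have hNpos : (0 : ℝ) < N := by positivity
  have hone : (1 : ℝ) < ((C * N ^ 2 : ℕ) : ℝ) := by
    exact_mod_cast (by nlinarith : 1 < C * N ^ 2)
  rw [le_div_iff₀ (Real.log_pos hone)]
  calc (r : ℝ) * Real.log ((C * N ^ 2 : ℕ) : ℝ)
      = r * (Real.log C + 2 * Real.log N) := by
        push_cast
        rw [Real.log_mul hCpos.ne' (by positivity), Real.log_pow]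
        norm_num
    _ ≤ N * Real.log 2 := hN
    _ = Real.log (2 ^ N) := (Real.log_pow _ _).symm
    _ ≤ _ := Real.log_le_log (by positivity) (by exact_mod_cast h N)

/-- A finitely generated `ℕ`-graded algebra `B` with `B₀ = k·1` admitting a
family of homogeneous elements `y_i`, of degrees bounded by `m·i + p`, whose ordered products
over finite strictly increasing sequences of indices are linearly independent, has infinite
Gelfand–Kirillov dimension. -/
theorem statement5 (k : Type*) [Field k]
    (B : Type*) [Ring B] [Algebra k B]
    (𝒜 : ℕ → Submodule k B)
    (hgrmul : ∀ i j : ℕ, 𝒜 i * 𝒜 j ≤ 𝒜 (i + j))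
    (hdirect : DirectSum.IsInternal 𝒜)
    (h0 : 𝒜 0 = 1)
    (hfg : Algebra.FiniteType k B)
    (m p : ℕ) (y : ℕ → B) (d : ℕ → ℕ)
    (hy : ∀ i, y i ∈ 𝒜 (d i))
    (hd : ∀ i, d i ≤ m * i + p)
    (hli : LinearIndependent k
      (fun s : Finset ℕ => ((s.sort (· ≤ ·)).map y).prod)) :
    GKdim k B = ⊤ := by
  let _ : GradedAlgebra 𝒜 :=
    { hdirect.chooseDecomposition with
      one_mem := h0 ▸ Submodule.one_le.mp le_rfl
      mul_mem := fun i j _ _ ha hb => hgrmul i j (Submodule.mul_mem_mul ha hb) }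
  obtain ⟨V, hV, h1, hle⟩ := exists_finiteDimensional_homogeneous_le_pow 𝒜 h0 hfg
  refine GKdim_eq_top_of_two_pow_le V (m + p + 1) (by omega) fun N => ?_
  set W := ∑ j ∈ Finset.range ((m + p + 1) * N ^ 2 + 1), V ^ j with hW
  have hWfg : W.FG := by
    refine Finset.sum_induction _ Submodule.FG (fun _ _ => Submodule.FG.sup)
      Submodule.fg_bot fun j _ => Submodule.FG.pow ?_ j
    exact Module.Finite.iff_fg.mp hV
  have : FiniteDimensional k W := Module.Finite.iff_fg.mpr hWfg
  have hmem : ∀ s : (Finset.range N).powerset,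
      (((s : Finset ℕ).sort (· ≤ ·)).map y).prod ∈ W := by
    rintro ⟨s, hs⟩
    have hs := Finset.mem_powerset.mp hs
    have hdeg : ((s.sort (· ≤ ·)).map d).sum ≤ (m + p + 1) * N ^ 2 := by
      have hsum : ((s.sort (· ≤ ·)).map d).sum ≤
          ((s.sort (· ≤ ·)).map d).length • (m * N + p) := by
        refine List.sum_le_card_nsmul _ _ fun x hx => ?_
        obtain ⟨i, hi, rfl⟩ := List.mem_map.mp hx
        have hiN : i < N := Finset.mem_range.mp (hs ((Finset.mem_sort _).mp hi))
        exact (hd i).trans (by gcongr)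
      have hcard : s.card ≤ N := by simpa using Finset.card_le_card hs
      rw [List.length_map, Finset.length_sort, smul_eq_mul] at hsum
      refine hsum.trans ((Nat.mul_le_mul_right _ hcard).trans ?_)
      nlinarith [Nat.mul_le_mul_left p (Nat.le_self_pow two_ne_zero N)]
    have hprod := hle _ (SetLike.list_prod_map_mem_graded (A := 𝒜) (s.sort (· ≤ ·)) d y
      fun i _ => hy i)
    exact Finset.single_le_sum (f := fun j => V ^ j) (fun _ _ => bot_le)
      (Finset.mem_range.mpr (Nat.lt_succ_of_le hdeg)) hprod
  have hli' : LinearIndependent k (fun s : (Finset.range N).powerset =>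
      (⟨_, hmem s⟩ : W)) :=
    LinearIndependent.of_comp W.subtype (hli.comp _ Subtype.val_injective)
  simpa using hli'.fintype_card_le_finrank
end
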